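/- Good lambda method with small-boundary cubes: Let μ be a Radon measure on ℝ^d of degree n ∈ (0,d] and let T be an n-dimensional singular integral operator with Calderón–Zygmund kernel K. Let b > 0 and C₁ be big enough constants (depending only on d) and let θ > 0. Suppose that for every μ-(5,b)-doubling cube Q with C₁-small boundary with respect to μ there exists a subset G_Q ⊂ Q with μ(G_Q) ≥ θ μ(Q) such that the maximal truncation T_* is bounded from M(ℝ^d) into L^{1,∞}(μ⌊G_Q) with norm bounded uniformly in Q. Then T_μ is bounded on L^p(μ) for every 1 < p < ∞ (i.e., the truncations T_{μ,ε} are bounded on L^p(μ) uniformly in ε > 0), with norm depending on p and on the preceding constants. -/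

import Mathlib

open MeasureTheory Metric Set ENNReal

noncomputable section

abbrev Pt (d : ℕ) := EuclideanSpace ℝ (Fin d)

structure Cube (d : ℕ) where
  center : Pt d
  side : ℝ

def Cube.toSet {d : ℕ} (Q : Cube d) : Set (Pt d) :=
  {x | ∀ i, |x i - Q.center i| ≤ Q.side / 2}

def Cube.scale {d : ℕ} (a : ℝ) (Q : Cube d) : Cube d := ⟨Q.center, a * Q.side⟩

def HasDegree {d : ℕ} (μ : Measure (Pt d)) (n C₀ : ℝ) : Prop :=
  ∀ (x : Pt d) (r : ℝ), 0 < r → μ (ball x r) ≤ ENNReal.ofReal (C₀ * r ^ n)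

structure IsCZKernel {d : ℕ} (K : Pt d → Pt d → ℂ) (n C α : ℝ) : Prop where
  size : ∀ x y : Pt d, x ≠ y → ‖K x y‖ ≤ C / dist x y ^ n
  smooth_fst : ∀ x x' y : Pt d, x ≠ y → 2 * dist x x' ≤ dist x y →
    ‖K x y - K x' y‖ ≤ C * dist x x' ^ α / dist x y ^ (n + α)
  smooth_snd : ∀ x y y' : Pt d, x ≠ y → 2 * dist y y' ≤ dist x y →
    ‖K x y - K x y'‖ ≤ C * dist y y' ^ α / dist x y ^ (n + α)

def truncT {d : ℕ} (μ : Measure (Pt d)) (K : Pt d → Pt d → ℂ) (ε : ℝ) (f : Pt d → ℂ)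
    (x : Pt d) : ℂ :=
  ∫ y in {y | ε < dist x y}, K x y * f y ∂μ

def maxT {d : ℕ} (μ : Measure (Pt d)) (K : Pt d → Pt d → ℂ) (δ : ℝ) (f : Pt d → ℂ)
    (x : Pt d) : ℝ≥0∞ :=
  ⨆ (ε : ℝ) (_ : δ < ε), (‖truncT μ K ε f x‖₊ : ℝ≥0∞)

def ballMax {d : ℕ} (μ : Measure (Pt d)) (f : Pt d → ℂ) (x : Pt d) : ℝ≥0∞ :=
  ⨆ (r : ℝ) (_ : 0 < r), (∫⁻ y in ball x r, ‖f y‖₊ ∂μ) / μ (ball x r)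

def cubeMax {d : ℕ} (μ : Measure (Pt d)) (p : ℝ) (f : Pt d → ℂ) (x : Pt d) : ℝ≥0∞ :=
  ⨆ (r : ℝ) (_ : 0 < r),
    ((∫⁻ y in (Cube.toSet ⟨x, 2 * r⟩), (‖f y‖₊ : ℝ≥0∞) ^ p ∂μ) / μ (Cube.toSet ⟨x, 2 * r⟩)) ^ (1 / p)

def IsAdmissible {d : ℕ} (μ : Measure (Pt d)) (Q : Cube d) (p B₁ : ℝ) (b : Pt d → ℂ) : Prop :=
  (∀ x ∉ Q.toSet, b x = 0) ∧
  (∫ x in Q.toSet, b x ∂μ = ((μ Q.toSet).toReal : ℂ)) ∧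
  (∫⁻ x in Q.toSet, (‖b x‖₊ : ℝ≥0∞) ^ p ∂μ ≤ ENNReal.ofReal B₁ * μ Q.toSet)

def IsDoubling {d : ℕ} (μ : Measure (Pt d)) (a b : ℝ) (Q : Cube d) : Prop :=
  μ (Cube.scale a Q).toSet ≤ ENNReal.ofReal b * μ Q.toSet

def SmallBoundary {d : ℕ} (μ : Measure (Pt d)) (t : ℝ) (Q : Cube d) : Prop :=
  ∀ lam : ℝ, 0 < lam →
    μ {x ∈ (Cube.scale 5 Q).toSet | infDist x (frontier Q.toSet) ≤ lam * Q.side}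
      ≤ ENNReal.ofReal (t * lam) * μ (Cube.scale 5 Q).toSet

def Cube.dyadicPiece {d : ℕ} (R : Cube d) (j : ℕ) (m : Fin d → Fin (2 ^ j)) : Cube d :=
  ⟨(WithLp.equiv 2 (Fin d → ℝ)).symm
      (fun i => R.center i - R.side / 2 + R.side / 2 ^ j * ((m i : ℝ) + 1 / 2)),
    R.side / 2 ^ j⟩


namespace GLam

theorem vitali_family {E : Type*} [MetricSpace E] [SecondCountableTopology E]
    (S : Set E) (r : E → ℝ) (R : ℝ) (hr : ∀ x ∈ S, 0 < r x) (hR : ∀ x ∈ S, r x ≤ R) :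
    ∃ u ⊆ S, u.Countable ∧ u.PairwiseDisjoint (fun x => closedBall x (r x)) ∧
      S ⊆ ⋃ x ∈ u, closedBall x (5 * r x) := by
  obtain ⟨u, hu, hd, hc⟩ := Vitali.exists_disjoint_subfamily_covering_enlargement_closedBall
    S (fun x => x) r R hR 5 (by norm_num)
  refine ⟨u, hu, ?_, hd, ?_⟩
  · refine hd.countable_of_nonempty_interior fun x hx => ?_
    exact ⟨x, ball_subset_interior_closedBall (mem_ball_self (hr x (hu hx)))⟩
  · intro x hx
    obtain ⟨b, hb, h⟩ := hc x hx
    exact mem_biUnion hb (h (mem_closedBall_self (hr x hx).le))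

theorem vitali_bdd {E : Type*} [MetricSpace E] [SecondCountableTopology E]
    [MeasurableSpace E] [BorelSpace E] (σ ν : Measure E) (c : ℝ≥0∞) (S U : Set E) (R : ℝ)
    (h : ∀ x ∈ S, ∃ r, 0 < r ∧ r ≤ R ∧ closedBall x r ⊆ U ∧
      σ (closedBall x (5 * r)) ≤ c * ν (closedBall x r)) : σ S ≤ c * ν U := by
  choose! r hr hR hU hσ using h
  obtain ⟨u, hu, hcu, hd, hc⟩ := vitali_family S r R hr hR
  have := hcu.to_subtype
  calc σ S ≤ σ (⋃ x ∈ u, closedBall x (5 * r x)) := measure_mono hc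
    _ ≤ ∑' x : u, σ (closedBall x.1 (5 * r x)) := measure_biUnion_le _ hcu _
    _ ≤ ∑' x : u, c * ν (closedBall x.1 (r x)) :=
        ENNReal.tsum_le_tsum fun x => hσ x (hu x.2)
    _ = c * ∑' x : u, ν (closedBall x.1 (r x)) := ENNReal.tsum_mul_left
    _ = c * ν (⋃ x ∈ u, closedBall x (r x)) := by
        rw [measure_biUnion hcu hd fun _ _ => isClosed_closedBall.measurableSet]
    _ ≤ c * ν U := by
        gcongr
        exact iUnion₂_subset fun x hx => hU x (hu hx)

theorem vitali_univ {E : Type*} [MetricSpace E] [SecondCountableTopology E]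
    [MeasurableSpace E] [BorelSpace E] (σ ν : Measure E) (c : ℝ≥0∞) (S : Set E)
    (h : ∀ x ∈ S, ∃ r, 0 < r ∧
      σ (closedBall x (5 * r)) ≤ c * ν (closedBall x r)) : σ S ≤ c * ν univ := by
  choose! r hr hσ using h
  have hS : S = ⋃ k : ℕ, {x ∈ S | r x ≤ k} := by
    ext x
    simp only [mem_iUnion, mem_ofPred_eq, exists_and_left]
    exact ⟨fun hx => ⟨hx, exists_nat_ge _⟩, fun hx => hx.1⟩
  rw [hS, Monotone.measure_iUnion]
  · refine iSup_le fun k => vitali_bdd σ ν c _ univ k ?_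
    rintro x ⟨hx, hk⟩
    exact ⟨r x, hr x hx, hk, subset_univ _, hσ x hx⟩
  · intro i j hij x hx
    exact ⟨hx.1, hx.2.trans (by exact_mod_cast hij)⟩

/-- annular decomposition -/
theorem lintegral_annuli {E : Type*} [MetricSpace E]
    [MeasurableSpace E] [BorelSpace E] (ρ : Measure E) (x : E) (s : ℕ → ℝ)
    (W : ℕ → ℝ≥0∞) (F : E → ℝ≥0∞) (S : Set E) (J : Set ℕ)
    (hS : ∀ y ∈ S, ∃ j ∈ J, s j < dist x y ∧ dist x y ≤ s (j+1))
    (hF : ∀ j y, s j < dist x y → F y ≤ W j) :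
    ∫⁻ y in S, F y ∂ρ ≤ ∑' j : J, W j * ρ (closedBall x (s (j+1))) := by
  have hsub : S ⊆ ⋃ j : J, {y | s j < dist x y ∧ dist x y ≤ s (j+1)} := by
    intro y hy
    obtain ⟨j, hj, h⟩ := hS y hy
    exact mem_iUnion.2 ⟨⟨j, hj⟩, h⟩
  calc ∫⁻ y in S, F y ∂ρ ≤ ∫⁻ y in ⋃ j : J, {y | s j < dist x y ∧ dist x y ≤ s (j+1)}, F y ∂ρ :=
        lintegral_mono_set hsub
    _ ≤ ∑' j : J, ∫⁻ y in {y | s j < dist x y ∧ dist x y ≤ s (j+1)}, F y ∂ρ :=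
        lintegral_iUnion_le _ _
    _ ≤ _ := by
        refine ENNReal.tsum_le_tsum fun j => ?_
        calc ∫⁻ y in {y | s j < dist x y ∧ dist x y ≤ s (j+1)}, F y ∂ρ
            ≤ ∫⁻ y in {y | s j < dist x y ∧ dist x y ≤ s (j+1)}, W j ∂ρ := by
              refine setLIntegral_mono' ?_ fun y hy => hF j y hy.1
              have hm : Measurable fun y => dist x y := by fun_prop
              exact (measurableSet_lt measurable_const hm).inter
                (measurableSet_le hm measurable_const)
          _ = W j * ρ {y | s j < dist x y ∧ dist x y ≤ s (j+1)} := by simp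
          _ ≤ _ := by
              gcongr
              intro y hy
              simpa [dist_comm] using hy.2

/-- existence of the annulus index -/
theorem exists_annulus {a s t : ℝ} (ha : 1 < a) (hs : 0 < s) (h : s < t) :
    ∃ j : ℕ, a ^ j * s < t ∧ t ≤ a ^ (j+1) * s := by
  classical
  have hex : ∃ j : ℕ, t ≤ a ^ j * s := by
    obtain ⟨j, hj⟩ := pow_unbounded_of_one_lt (t / s) ha
    exact ⟨j, ((div_lt_iff₀ hs).1 hj).le⟩
  have h0 : Nat.find hex ≠ 0 := by
    intro h0
    have := Nat.find_spec hex
    rw [h0] at this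
    simp at this
    linarith
  obtain ⟨m, hm⟩ := Nat.exists_eq_succ_of_ne_zero h0
  refine ⟨m, ?_, ?_⟩
  · have := Nat.find_min hex (m := m) (by omega)
    linarith [not_le.1 this]
  · have := Nat.find_spec hex
    rwa [hm] at this

/-- far integral estimate (I2) -/
theorem far_integral {E : Type*} [MetricSpace E]
    [MeasurableSpace E] [BorelSpace E] {n α : ℝ} (hn : 0 < n) (hα : 0 < α) (ρ : Measure E) (x : E)
    {D τ : ℝ} (hD : 0 < D) (hτ : 0 ≤ τ)
    (h : ∀ s, D ≤ s → ρ (closedBall x s) ≤ ENNReal.ofReal (τ * s ^ n)) :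
    ∫⁻ y in {y | D < dist x y}, ENNReal.ofReal ((D / dist x y) ^ α / dist x y ^ n) ∂ρ
      ≤ ENNReal.ofReal (τ * (2 ^ n * (1 - (2:ℝ) ^ (-α))⁻¹)) := by
  have hq : (2:ℝ) ^ (-α) < 1 := Real.rpow_lt_one_of_one_lt_of_neg (by norm_num) (by linarith)
  have hq0 : 0 < (2:ℝ) ^ (-α) := by positivity
  refine (lintegral_annuli ρ x (fun j => 2 ^ j * D)
    (fun j => ENNReal.ofReal ((D / (2 ^ j * D)) ^ α / (2 ^ j * D) ^ n)) _ _ univ ?_ ?_).trans ?_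
  · intro y hy
    obtain ⟨j, hj⟩ := exists_annulus (a := 2) (by norm_num) hD hy
    exact ⟨j, mem_univ _, hj⟩
  · intro j y hy
    have : 0 < 2 ^ j * D := by positivity
    apply ENNReal.ofReal_le_ofReal
    have h2 : 0 < dist x y := this.trans hy
    gcongr
  · rw [tsum_univ (fun j : ℕ => ENNReal.ofReal ((D / (2 ^ j * D)) ^ α / (2 ^ j * D) ^ n) *
      ρ (closedBall x (2 ^ (j+1) * D)))]
    calc ∑' j : ℕ, ENNReal.ofReal ((D / (2 ^ j * D)) ^ α / (2 ^ j * D) ^ n) *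
          ρ (closedBall x (2 ^ (j+1) * D))
        ≤ ∑' j : ℕ, ENNReal.ofReal (τ * 2 ^ n * ((2:ℝ) ^ (-α)) ^ j) := by
          refine ENNReal.tsum_le_tsum fun j => ?_
          have h1 := h (2 ^ (j+1) * D) (by
            have : (1:ℝ) ≤ 2 ^ (j+1) := one_le_pow₀ (by norm_num)
            nlinarith)
          refine (mul_le_mul_right h1 _).trans ?_
          rw [← ENNReal.ofReal_mul (by positivity)]
          apply le_of_eq
          congr 1
          have e1 : (2 ^ (j+1) * D) ^ n = 2 ^ n * (2 ^ j * D) ^ n := by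
            rw [← Real.mul_rpow (by positivity) (by positivity)]; congr 1; ring
          have e2 : (D / (2 ^ j * D)) ^ α = ((2:ℝ) ^ (-α)) ^ j := by
            have : D / (2 ^ j * D) = (2:ℝ) ^ (-(j:ℝ)) := by
              rw [Real.rpow_neg (by norm_num), Real.rpow_natCast]; field_simp
            rw [this, ← Real.rpow_mul (by norm_num), ← Real.rpow_natCast, ← Real.rpow_mul (by norm_num)]
            congr 1; ring
          rw [e1, e2]
          have : (2 ^ j * D) ^ n ≠ 0 := by positivity
          field_simp
      _ = ENNReal.ofReal (∑' j : ℕ, (τ * 2 ^ n * ((2:ℝ) ^ (-α)) ^ j)) := by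
          rw [ENNReal.ofReal_tsum_of_nonneg (fun j => by positivity)]
          exact (summable_geometric_of_lt_one hq0.le hq).mul_left _
      _ = _ := by
          rw [tsum_mul_left, tsum_geometric_of_lt_one hq0.le hq]; ring_nf

/-- chain integral estimate (I1) -/
theorem chain_integral {E : Type*} [MetricSpace E]
    [MeasurableSpace E] [BorelSpace E] {n a b c τ s : ℝ} (hn : 0 < n) (ha : 1 < a)
    (hb : 2 * a ^ n ≤ b) (hc : 0 ≤ c) (hτ : 0 ≤ τ) (hs : 0 < s) (σ ρ : Measure E) (x : E) (k : ℕ)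
    (hσ : ∀ r, 0 < r → σ (closedBall x r) ≤ ENNReal.ofReal (c * r ^ n))
    (hnd : ∀ j, 1 ≤ j → j < k → ENNReal.ofReal b * σ (closedBall x (a ^ j * s)) ≤
      σ (closedBall x (a ^ (j+1) * s)))
    (hρ : ∀ j, 1 ≤ j → ρ (closedBall x (a ^ j * s)) ≤
      ENNReal.ofReal τ * σ (closedBall x (a ^ (j+1) * s))) :
    ∫⁻ y in {y | s < dist x y ∧ dist x y ≤ a ^ k * s}, ENNReal.ofReal (1 / dist x y ^ n) ∂ρ
      ≤ ENNReal.ofReal (τ * (4 * c * a ^ (2 * n))) := by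
  have ha0 : 0 < a := by linarith
  have han : 0 < a ^ n := by positivity
  have hb0 : 0 < b := by linarith
  have key : ∀ i, ∀ j, 1 ≤ j → j + i = k → σ (closedBall x (a ^ j * s)) ≤
      ENNReal.ofReal (c * (a ^ j * s) ^ n * (1/2) ^ i) := by
    intro i
    induction i with
    | zero => intro j _ _; simpa using hσ (a ^ j * s) (by positivity)
    | succ i ih =>
      intro j hj hjk
      have h1 := ih (j+1) (by omega) (by omega)
      have h2 := (hnd j hj (by omega)).trans h1
      have h3 : σ (closedBall x (a ^ j * s)) ≤ ENNReal.ofReal (c * (a ^ (j+1) * s) ^ n * (1/2) ^ i / b) := by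
        rw [ENNReal.ofReal_div_of_pos hb0, ENNReal.le_div_iff_mul_le (by simp [hb0]) (by simp), mul_comm]
        exact h2
      refine h3.trans (ENNReal.ofReal_le_ofReal ?_)
      rw [div_le_iff₀ hb0]
      have e1 : (a ^ (j+1) * s) ^ n = a ^ n * (a ^ j * s) ^ n := by
        rw [← Real.mul_rpow (by positivity) (by positivity)]; congr 1; ring
      rw [e1, pow_succ]
      have : 0 ≤ c * (a ^ j * s) ^ n * (1/2) ^ i := by positivity
      nlinarith
  refine (lintegral_annuli ρ x (fun j => a ^ j * s)
    (fun j => ENNReal.ofReal (1 / (a ^ j * s) ^ n)) _ _ (Set.Iio k) ?_ ?_).trans ?_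
  · rintro y ⟨hy, hy2⟩
    obtain ⟨j, hj⟩ := exists_annulus ha hs hy
    refine ⟨j, ?_, hj⟩
    by_contra hjk
    simp only [mem_Iio, not_lt] at hjk
    have : a ^ k ≤ a ^ j := pow_le_pow_right₀ ha.le hjk
    nlinarith
  · intro j y hy
    have : 0 < a ^ j * s := by positivity
    apply ENNReal.ofReal_le_ofReal
    gcongr
  · calc ∑' j : Set.Iio k, ENNReal.ofReal (1 / (a ^ (j:ℕ) * s) ^ n) *
          ρ (closedBall x (a ^ ((j:ℕ)+1) * s))
        ≤ ∑' j : Set.Iio k, ENNReal.ofReal (τ * (4 * c * a ^ (2 * n)) * (1/2) ^ (k - (j:ℕ))) := by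
          refine ENNReal.tsum_le_tsum fun ⟨j, hj⟩ => ?_
          simp only [mem_Iio] at hj
          have h1 : σ (closedBall x (a ^ (j+2) * s)) ≤
              ENNReal.ofReal (c * (a ^ (j+2) * s) ^ n * (4 * (1/2) ^ (k - j))) := by
            rcases Nat.lt_or_ge k (j+2) with h | h
            · refine (hσ _ (by positivity)).trans (ENNReal.ofReal_le_ofReal ?_)
              have : k - j = 1 := by omega
              rw [this]
              have : 0 ≤ c * (a ^ (j+2) * s) ^ n := by positivity
              nlinarith
            · refine (key (k - (j+2)) (j+2) (by omega) (by omega)).trans (ENNReal.ofReal_le_ofReal ?_)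
              have : k - j = (k - (j+2)) + 2 := by omega
              rw [this, pow_add]
              apply le_of_eq; ring
          have h2 := (hρ (j+1) (by omega)).trans (mul_le_mul_right h1 _)
          refine (mul_le_mul_right h2 _).trans ?_
          rw [← ENNReal.ofReal_mul hτ, ← ENNReal.ofReal_mul (by positivity)]
          apply ENNReal.ofReal_le_ofReal
          have e1 : (a ^ (j+2) * s) ^ n = a ^ (2 * n) * (a ^ j * s) ^ n := by
            have : a ^ (2 * n) = (a ^ 2) ^ n := by
              rw [← Real.rpow_natCast, ← Real.rpow_mul ha0.le]; norm_num
            rw [this, ← Real.mul_rpow (by positivity) (by positivity)]; congr 1; ring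
          rw [e1]
          have : (a ^ j * s) ^ n ≠ 0 := by positivity
          apply le_of_eq
          field_simp
      _ = ENNReal.ofReal (∑ j ∈ Finset.range k, τ * (4 * c * a ^ (2 * n)) * (1/2) ^ (k - j)) := by
          rw [ENNReal.ofReal_sum_of_nonneg (fun j _ => by positivity)]
          have : (Set.Iio k) = ((Finset.range k : Finset ℕ) : Set ℕ) := by ext; simp
          rw [this]
          exact Finset.tsum_subtype (Finset.range k) (fun j => ENNReal.ofReal (τ * (4 * c * a ^ (2 * n)) * (1/2) ^ (k - j)))
      _ ≤ _ := by
          apply ENNReal.ofReal_le_ofReal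
          rw [← Finset.mul_sum]
          apply mul_le_of_le_one_right (by positivity)
          have : ∀ k : ℕ, ∑ j ∈ Finset.range k, (1/2 : ℝ) ^ (k - j) = 1 - (1/2) ^ k := by
            intro k
            induction k with
            | zero => simp
            | succ k ih =>
              rw [Finset.sum_range_succ]
              have : ∀ j ∈ Finset.range k, (1/2 : ℝ) ^ (k + 1 - j) = (1/2) * (1/2) ^ (k - j) := by
                intro j hj
                have : k + 1 - j = (k - j) + 1 := by
                  have := Finset.mem_range.1 hj; omega
                rw [this, pow_succ]; ring
              rw [Finset.sum_congr rfl this, ← Finset.mul_sum, ih, pow_succ]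
              norm_num
              ring
          rw [this]
          have : (0:ℝ) < (1/2) ^ k := by positivity
          linarith

end GLam

namespace GLam

def phi (t : ℝ) : ℝ := min 1 (max 0 (t - 1))

theorem phi_nonneg (t : ℝ) : 0 ≤ phi t := le_min zero_le_one (le_max_left _ _)
theorem phi_le_one (t : ℝ) : phi t ≤ 1 := min_le_left _ _
theorem phi_zero {t : ℝ} (h : t ≤ 1) : phi t = 0 := by
  unfold phi; rw [max_eq_left (by linarith)]; simp
theorem phi_one {t : ℝ} (h : 2 ≤ t) : phi t = 1 := by
  unfold phi; rw [max_eq_right (by linarith), min_eq_left (by linarith)]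
theorem phi_lip (s t : ℝ) : |phi s - phi t| ≤ |s - t| := by
  unfold phi
  refine (abs_min_sub_min_le_max _ _ _ _).trans ?_
  simp only [sub_self, abs_zero]
  refine max_le (abs_nonneg _) ?_
  refine (abs_max_sub_max_le_max _ _ _ _).trans ?_
  simp
theorem phi_cont : Continuous phi := by unfold phi; fun_prop

variable {d : ℕ}

def kr (K : Pt d → Pt d → ℂ) (r : ℝ) (x y : Pt d) : ℂ := (phi (dist x y / r) : ℂ) * K x y

theorem norm_kr_le_K (K : Pt d → Pt d → ℂ) (r : ℝ) (x y : Pt d) : ‖kr K r x y‖ ≤ ‖K x y‖ := by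
  unfold kr
  rw [norm_mul, Complex.norm_real, Real.norm_eq_abs, abs_of_nonneg (phi_nonneg _)]
  exact mul_le_of_le_one_left (norm_nonneg _) (phi_le_one _)

theorem kr_zero (K : Pt d → Pt d → ℂ) {r : ℝ} (hr : 0 < r) {x y : Pt d} (h : dist x y ≤ r) :
    kr K r x y = 0 := by
  unfold kr
  rw [phi_zero ((div_le_one hr).2 h)]; simp

theorem kr_eq (K : Pt d → Pt d → ℂ) {r : ℝ} (hr : 0 < r) {x y : Pt d} (h : 2 * r ≤ dist x y) :
    kr K r x y = K x y := by
  unfold kr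
  rw [phi_one ((le_div_iff₀ hr).2 h)]; simp

variable {n C α : ℝ} {K : Pt d → Pt d → ℂ}

theorem K_smooth (hK : IsCZKernel K n C α) {x x' y : Pt d} (hxy : x ≠ y)
    (h : 2 * dist x x' ≤ dist x y) :
    ‖K x y - K x' y‖ ≤ C * (dist x x' / dist x y) ^ α / dist x y ^ n := by
  refine (hK.smooth_fst x x' y hxy h).trans (le_of_eq ?_)
  have h0 : 0 < dist x y := dist_pos.2 hxy
  rw [Real.div_rpow dist_nonneg h0.le, Real.rpow_add h0]
  field_simp

theorem kr_smooth (hK : IsCZKernel K n C α) (hC : 0 < C) (hα : 0 < α) (hα1 : α ≤ 1)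
    {r : ℝ} (hr : 0 < r) {x x' y : Pt d} (hxy : x ≠ y) (h : 2 * dist x x' ≤ dist x y) :
    ‖kr K r x y - kr K r x' y‖ ≤ 5 * C * (dist x x' / dist x y) ^ α / dist x y ^ n := by
  have h0 : 0 < dist x y := dist_pos.2 hxy
  set t := dist x x' / dist x y with ht
  have ht0 : 0 ≤ t := by positivity
  have ht1 : t ≤ 1 := by rw [ht, div_le_one h0]; linarith [dist_nonneg (x := x) (y := x')]
  have htα : t ≤ t ^ α := by
    rcases ht0.eq_or_lt with h | h
    · rw [← h, Real.zero_rpow hα.ne']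
    · calc t = t ^ (1:ℝ) := (Real.rpow_one t).symm
        _ ≤ _ := Real.rpow_le_rpow_of_exponent_ge h ht1 hα1
  have hs := K_smooth hK hxy h
  have hx'y : dist x y / 2 ≤ dist x' y := by
    have := dist_triangle x x' y
    linarith
  have hphi : |phi (dist x y / r) - phi (dist x' y / r)| ≤ 4 * t ^ α := by
    rcases le_or_gt (4 * r) (dist x y) with h4 | h4
    · rw [phi_one ((le_div_iff₀ hr).2 (by linarith)), phi_one ((le_div_iff₀ hr).2 (by linarith))]
      simp; positivity
    · refine (phi_lip _ _).trans ?_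
      rw [← sub_div, abs_div, abs_of_pos hr]
      have : |dist x y - dist x' y| ≤ dist x x' := abs_dist_sub_le x x' y
      calc |dist x y - dist x' y| / r ≤ dist x x' / (dist x y / 4) := by
            gcongr; linarith
        _ = 4 * t := by rw [ht]; field_simp
        _ ≤ _ := by linarith
  have e : kr K r x y - kr K r x' y = ((phi (dist x y / r) - phi (dist x' y / r) : ℝ) : ℂ) * K x y
      + (phi (dist x' y / r) : ℂ) * (K x y - K x' y) := by
    unfold kr; push_cast; ring
  rw [e]
  refine (norm_add_le _ _).trans ?_
  rw [norm_mul, norm_mul, Complex.norm_real, Complex.norm_real, Real.norm_eq_abs, Real.norm_eq_abs,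
    abs_of_nonneg (phi_nonneg _)]
  have hz := hK.size x y hxy
  calc _ ≤ 4 * t ^ α * (C / dist x y ^ n) + 1 * (C * t ^ α / dist x y ^ n) := by
        gcongr
        exact phi_le_one _
    _ = _ := by ring

theorem norm_kr_le_const (hK : IsCZKernel K n C α) (hn : 0 < n) (hC : 0 < C)
    {r : ℝ} (hr : 0 < r) (x y : Pt d) : ‖kr K r x y‖ ≤ C / r ^ n := by
  rcases le_or_gt (dist x y) r with h | h
  · rw [kr_zero K hr h]; simp; positivity
  · have h0 : 0 < dist x y := hr.trans h
    refine ((norm_kr_le_K K r x y).trans (hK.size x y (dist_pos.1 h0))).trans ?_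
    gcongr

theorem K_cont_fst (hK : IsCZKernel K n C α) (hα : 0 < α) {x y : Pt d} (hxy : x ≠ y) :
    ContinuousAt (fun z => K z y) x := by
  have h0 : 0 < dist x y := dist_pos.2 hxy
  rw [ContinuousAt, tendsto_iff_norm_sub_tendsto_zero]
  have hl : Filter.Tendsto (fun z => C * dist x z ^ α / dist x y ^ (n + α)) (nhds x) (nhds 0) := by
    have : Filter.Tendsto (fun z => C * dist x z ^ α / dist x y ^ (n + α)) (nhds x)
        (nhds (C * dist x x ^ α / dist x y ^ (n + α))) := by
      apply Filter.Tendsto.div_const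
      apply Filter.Tendsto.const_mul
      have : Filter.Tendsto (fun z => dist x z) (nhds x) (nhds (dist x x)) :=
        (continuous_const.dist continuous_id).tendsto x
      exact this.rpow_const (Or.inr hα.le)
    simpa [Real.zero_rpow hα.ne'] using this
  refine squeeze_zero' (Filter.Eventually.of_forall fun _ => norm_nonneg _) ?_ hl
  have : ∀ᶠ z in nhds x, dist z x < dist x y / 2 := Metric.ball_mem_nhds x (by positivity)
  filter_upwards [this] with z hz
  rw [norm_sub_rev]
  rw [dist_comm] at hz
  exact hK.smooth_fst x z y hxy (by linarith)

theorem K_cont_snd (hK : IsCZKernel K n C α) (hα : 0 < α) {x y : Pt d} (hxy : x ≠ y) :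
    ContinuousAt (fun z => K x z) y := by
  have h0 : 0 < dist x y := dist_pos.2 hxy
  rw [ContinuousAt, tendsto_iff_norm_sub_tendsto_zero]
  have hl : Filter.Tendsto (fun z => C * dist y z ^ α / dist x y ^ (n + α)) (nhds y) (nhds 0) := by
    have : Filter.Tendsto (fun z => C * dist y z ^ α / dist x y ^ (n + α)) (nhds y)
        (nhds (C * dist y y ^ α / dist x y ^ (n + α))) := by
      apply Filter.Tendsto.div_const
      apply Filter.Tendsto.const_mul
      have : Filter.Tendsto (fun z => dist y z) (nhds y) (nhds (dist y y)) :=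
        (continuous_const.dist continuous_id).tendsto y
      exact this.rpow_const (Or.inr hα.le)
    simpa [Real.zero_rpow hα.ne'] using this
  refine squeeze_zero' (Filter.Eventually.of_forall fun _ => norm_nonneg _) ?_ hl
  have : ∀ᶠ z in nhds y, dist z y < dist x y / 2 := Metric.ball_mem_nhds y (by positivity)
  filter_upwards [this] with z hz
  rw [norm_sub_rev]
  rw [dist_comm] at hz
  exact hK.smooth_snd x y z hxy (by linarith)

theorem kr_cont_fst (hK : IsCZKernel K n C α) (hα : 0 < α) {r : ℝ} (hr : 0 < r) (y : Pt d) :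
    Continuous (fun x => kr K r x y) := by
  rw [continuous_iff_continuousAt]
  intro x
  by_cases hxy : x = y
  · have : ∀ᶠ z in nhds x, kr K r z y = 0 := by
      filter_upwards [Metric.ball_mem_nhds x hr] with z hz
      subst hxy
      exact kr_zero K hr (le_of_lt hz)
    exact (continuousAt_const (y := (0:ℂ))).congr (this.mono fun _ h => h.symm)
  · unfold kr
    apply ContinuousAt.mul _ (K_cont_fst hK hα hxy)
    apply Continuous.continuousAt
    exact Complex.continuous_ofReal.comp (phi_cont.comp (by fun_prop))

theorem kr_cont_snd (hK : IsCZKernel K n C α) (hα : 0 < α) {r : ℝ} (hr : 0 < r) (x : Pt d) :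
    Continuous (fun y => kr K r x y) := by
  rw [continuous_iff_continuousAt]
  intro y
  by_cases hxy : x = y
  · have : ∀ᶠ z in nhds y, kr K r x z = 0 := by
      filter_upwards [Metric.ball_mem_nhds y hr] with z hz
      subst hxy
      exact kr_zero K hr (by rw [dist_comm]; exact le_of_lt hz)
    exact (continuousAt_const (y := (0:ℂ))).congr (this.mono fun _ h => h.symm)
  · unfold kr
    apply ContinuousAt.mul _ (K_cont_snd hK hα hxy)
    apply Continuous.continuousAt
    exact Complex.continuous_ofReal.comp (phi_cont.comp (by fun_prop))

def Tr (K : Pt d → Pt d → ℂ) (r : ℝ) (ρ : Measure (Pt d)) (g : Pt d → ℂ) (x : Pt d) : ℂ :=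
  ∫ y, kr K r x y * g y ∂ρ

theorem integrable_kr (hK : IsCZKernel K n C α) (hn : 0 < n) (hC : 0 < C) (hα : 0 < α)
    {r : ℝ} (hr : 0 < r) (ρ : Measure (Pt d)) [IsFiniteMeasure ρ] {g : Pt d → ℂ}
    (hg : Measurable g) (hg1 : ∀ x, ‖g x‖ ≤ 1) (x : Pt d) :
    Integrable (fun y => kr K r x y * g y) ρ := by
  refine Integrable.of_bound (C := C / r ^ n) ?_ ?_
  · exact ((kr_cont_snd hK hα hr x).measurable.mul hg).aestronglyMeasurable
  · refine Filter.Eventually.of_forall fun y => ?_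
    rw [norm_mul]
    have := norm_kr_le_const hK hn hC hr x y
    have h2 := hg1 y
    calc _ ≤ (C / r ^ n) * 1 := by gcongr
      _ = _ := by ring

theorem Tr_cont (hK : IsCZKernel K n C α) (hn : 0 < n) (hC : 0 < C) (hα : 0 < α)
    {r : ℝ} (hr : 0 < r) (ρ : Measure (Pt d)) [IsFiniteMeasure ρ] {g : Pt d → ℂ}
    (hg : Measurable g) (hg1 : ∀ x, ‖g x‖ ≤ 1) : Continuous (Tr K r ρ g) := by
  unfold Tr
  refine continuous_of_dominated (bound := fun _ => C / r ^ n) ?_ ?_ (integrable_const _) ?_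
  · exact fun x => (integrable_kr hK hn hC hα hr ρ hg hg1 x).aestronglyMeasurable
  · intro x
    refine Filter.Eventually.of_forall fun y => ?_
    rw [norm_mul]
    have := norm_kr_le_const hK hn hC hr x y
    have h2 := hg1 y
    calc _ ≤ (C / r ^ n) * 1 := by gcongr
      _ = _ := by ring
  · exact Filter.Eventually.of_forall fun y => (kr_cont_fst hK hα hr y).mul continuous_const

def Ns (K : Pt d → Pt d → ℂ) (ε : ℝ) (ρ : Measure (Pt d)) (g : Pt d → ℂ) (x : Pt d) : ℝ≥0∞ :=
  ⨆ (r : ℝ) (_ : ε ≤ r), ‖Tr K r ρ g x‖ₑ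

theorem Ns_lsc (hK : IsCZKernel K n C α) (hn : 0 < n) (hC : 0 < C) (hα : 0 < α)
    {ε : ℝ} (hε : 0 < ε) (ρ : Measure (Pt d)) [IsFiniteMeasure ρ] {g : Pt d → ℂ}
    (hg : Measurable g) (hg1 : ∀ x, ‖g x‖ ≤ 1) : LowerSemicontinuous (Ns K ε ρ g) := by
  unfold Ns
  refine lowerSemicontinuous_iSup fun r => lowerSemicontinuous_iSup fun hr => ?_
  exact (Tr_cont hK hn hC hα (hε.trans_le hr) ρ hg hg1).enorm.lowerSemicontinuous

theorem lt_Ns_iff {ε : ℝ} {ρ : Measure (Pt d)} {g : Pt d → ℂ} {x : Pt d} {t : ℝ≥0∞} :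
    t < Ns K ε ρ g x ↔ ∃ r, ε ≤ r ∧ t < ‖Tr K r ρ g x‖ₑ := by
  simp [Ns, lt_iSup_iff]

end GLam

namespace GLam

variable {d : ℕ} {n C α : ℝ} {K : Pt d → Pt d → ℂ}

theorem meas_ann (x : Pt d) (s t : ℝ) :
    MeasurableSet {y : Pt d | s < dist x y ∧ dist x y ≤ t} := by
  have hm : Measurable fun y => dist x y := by fun_prop
  exact (measurableSet_lt measurable_const hm).inter (measurableSet_le hm measurable_const)

def cfar (n C α : ℝ) : ℝ := 20 * C * 2 ^ n * (2 ^ n * (1 - (2:ℝ) ^ (-α))⁻¹)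

theorem cfar_pos (hC : 0 < C) (hα : 0 < α) : 0 < cfar n C α := by
  have hq : (2:ℝ) ^ (-α) < 1 := Real.rpow_lt_one_of_one_lt_of_neg (by norm_num) (by linarith)
  have : 0 < 1 - (2:ℝ) ^ (-α) := by linarith
  unfold cfar; positivity

theorem far_compare (hn : 0 < n) (hC : 0 < C) (hα : 0 < α) (hα1 : α ≤ 1)
    (k : Pt d → Pt d → ℂ)
    (hk : ∀ p q y, p ≠ y → 2 * dist p q ≤ dist p y →
      ‖k p y - k q y‖ ≤ 5 * C * (dist p q / dist p y) ^ α / dist p y ^ n)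
    (ρ : Measure (Pt d)) (x p q : Pt d) {D τ : ℝ} (hD : 0 < D) (hτ : 0 ≤ τ)
    (hp : dist x p ≤ D) (hq : dist x q ≤ D)
    (h : ∀ s, D ≤ s → ρ (closedBall x s) ≤ ENNReal.ofReal (τ * s ^ n)) :
    ∫⁻ y in {y | 8 * D < dist x y}, ‖k p y - k q y‖ₑ ∂ρ ≤ ENNReal.ofReal (τ * cfar n C α) := by
  have hpt : ∀ y ∈ {y | 8 * D < dist x y}, ‖k p y - k q y‖ₑ ≤
      ENNReal.ofReal (20 * C * 2 ^ n) * ENNReal.ofReal ((D / dist x y) ^ α / dist x y ^ n) := by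
    intro y hy
    have hy : 8 * D < dist x y := hy
    have hxy : 0 < dist x y := by linarith
    have hpy : dist x y / 2 ≤ dist p y := by
      have := dist_triangle x p y; linarith
    have hpy0 : 0 < dist p y := by linarith
    have hpq : dist p q ≤ 2 * D := by
      have := dist_triangle_left p q x; linarith
    rw [← ENNReal.ofReal_mul (by positivity), ← ofReal_norm]
    apply ENNReal.ofReal_le_ofReal
    refine (hk p q y (dist_pos.1 hpy0) (by linarith)).trans ?_
    calc 5 * C * (dist p q / dist p y) ^ α / dist p y ^ n
        ≤ 5 * C * ((2 * D) / (dist x y / 2)) ^ α / (dist x y / 2) ^ n := by gcongr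
      _ = 5 * C * (4 ^ α * (D / dist x y) ^ α) / (dist x y ^ n / 2 ^ n) := by
          rw [← Real.mul_rpow (by norm_num) (by positivity), Real.div_rpow hxy.le (by norm_num)]
          congr 4; field_simp; ring
      _ ≤ 5 * C * (4 * (D / dist x y) ^ α) / (dist x y ^ n / 2 ^ n) := by
          gcongr
          calc (4:ℝ) ^ α ≤ 4 ^ (1:ℝ) := Real.rpow_le_rpow_of_exponent_le (by norm_num) hα1
            _ = 4 := Real.rpow_one 4
      _ = _ := by field_simp; ring
  have hm : MeasurableSet {y : Pt d | 8 * D < dist x y} :=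
    measurableSet_lt measurable_const (by fun_prop)
  calc _ ≤ ∫⁻ y in {y | 8 * D < dist x y}, ENNReal.ofReal (20 * C * 2 ^ n) *
          ENNReal.ofReal ((D / dist x y) ^ α / dist x y ^ n) ∂ρ := setLIntegral_mono' hm hpt
    _ ≤ ∫⁻ y in {y | D < dist x y}, ENNReal.ofReal (20 * C * 2 ^ n) *
          ENNReal.ofReal ((D / dist x y) ^ α / dist x y ^ n) ∂ρ := by
        apply lintegral_mono_set
        intro y (hy : 8 * D < dist x y)
        show D < dist x y
        linarith
    _ = ENNReal.ofReal (20 * C * 2 ^ n) * ∫⁻ y in {y | D < dist x y},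
          ENNReal.ofReal ((D / dist x y) ^ α / dist x y ^ n) ∂ρ :=
        lintegral_const_mul' _ _ ENNReal.ofReal_ne_top
    _ ≤ ENNReal.ofReal (20 * C * 2 ^ n) * ENNReal.ofReal (τ * (2 ^ n * (1 - (2:ℝ) ^ (-α))⁻¹)) := by
        gcongr
        exact far_integral hn hα ρ x hD hτ h
    _ = _ := by
        rw [← ENNReal.ofReal_mul (by positivity)]
        congr 1; unfold cfar; ring

theorem K_smooth5 (hK : IsCZKernel K n C α) (hC : 0 < C) {x x' y : Pt d} (hxy : x ≠ y)
    (h : 2 * dist x x' ≤ dist x y) :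
    ‖K x y - K x' y‖ ≤ 5 * C * (dist x x' / dist x y) ^ α / dist x y ^ n := by
  refine (K_smooth hK hxy h).trans ?_
  have : 0 ≤ C * (dist x x' / dist x y) ^ α / dist x y ^ n := by positivity
  calc _ ≤ 5 * (C * (dist x x' / dist x y) ^ α / dist x y ^ n) := by linarith
    _ = _ := by ring

theorem K_meas (hK : IsCZKernel K n C α) (hα : 0 < α) (x : Pt d) : Measurable (fun y => K x y) := by
  refine measurable_of_continuousOn_compl_singleton x ?_
  intro y hy
  exact (K_cont_snd hK hα (fun h => hy h.symm)).continuousWithinAt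

theorem integrableOn_hard (hK : IsCZKernel K n C α) (hn : 0 < n) (hC : 0 < C) (hα : 0 < α)
    {ε : ℝ} (hε : 0 < ε) (ρ : Measure (Pt d)) [IsFiniteMeasure ρ] {g : Pt d → ℂ}
    (hg : Measurable g) (hg1 : ∀ x, ‖g x‖ ≤ 1) (x : Pt d) :
    IntegrableOn (fun y => K x y * g y) {y | ε < dist x y} ρ := by
  refine Integrable.of_bound (C := C / ε ^ n) ?_ ?_
  · exact ((K_meas hK hα x).mul hg).aestronglyMeasurable
  · have hm : MeasurableSet {y : Pt d | ε < dist x y} :=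
      measurableSet_lt measurable_const (by fun_prop)
    filter_upwards [ae_restrict_mem hm] with y hy
    have hy : ε < dist x y := hy
    rw [norm_mul]
    have := hK.size x y (dist_pos.1 (hε.trans hy))
    have h2 := hg1 y
    calc _ ≤ (C / dist x y ^ n) * 1 := by gcongr
      _ ≤ C / ε ^ n := by rw [mul_one]; gcongr

theorem enorm_integral_le_kernel {ρ : Measure (Pt d)} {S : Set (Pt d)} {k : Pt d → ℂ} {g : Pt d → ℂ}
    (hg1 : ∀ x, ‖g x‖ ≤ 1) : ‖∫ y in S, k y * g y ∂ρ‖ₑ ≤ ∫⁻ y in S, ‖k y‖ₑ ∂ρ := by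
  refine (enorm_integral_le_lintegral_enorm _).trans (lintegral_mono fun y => ?_)
  rw [enorm_mul]
  have : ‖g y‖ₑ ≤ 1 := by
    rw [← ofReal_norm, ← ENNReal.ofReal_one]
    exact ENNReal.ofReal_le_ofReal (hg1 y)
  calc _ ≤ ‖k y‖ₑ * 1 := by gcongr
    _ = _ := mul_one _

/-- integral of the size bound over an annulus-like region -/
theorem near_bound (hK : IsCZKernel K n C α) (hn : 0 < n) (hC : 0 < C) (ρ : Measure (Pt d))
    (x : Pt d) {s t : ℝ} (hs : 0 < s) {τ : ℝ} (hτ : ρ (closedBall x t) ≤ ENNReal.ofReal τ)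
    (k : Pt d → ℂ) (hk : ∀ y, ‖k y‖ ≤ ‖K x y‖) :
    ∫⁻ y in {y | s < dist x y ∧ dist x y ≤ t}, ‖k y‖ₑ ∂ρ ≤ ENNReal.ofReal (C / s ^ n * τ) := by
  have hm : MeasurableSet {y : Pt d | s < dist x y ∧ dist x y ≤ t} :=
    meas_ann x s t
  calc _ ≤ ∫⁻ y in {y | s < dist x y ∧ dist x y ≤ t}, ENNReal.ofReal (C / s ^ n) ∂ρ := by
        refine setLIntegral_mono' hm fun y hy => ?_
        have hy : s < dist x y ∧ dist x y ≤ t := hy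
        rw [← ofReal_norm]
        apply ENNReal.ofReal_le_ofReal
        refine ((hk y).trans (hK.size x y (dist_pos.1 (hs.trans hy.1)))).trans ?_
        have := hy.1
        gcongr
    _ = ENNReal.ofReal (C / s ^ n) * ρ {y | s < dist x y ∧ dist x y ≤ t} := by simp
    _ ≤ ENNReal.ofReal (C / s ^ n) * ENNReal.ofReal τ := by
        gcongr
        refine (measure_mono fun y hy => ?_).trans hτ
        have hy : s < dist x y ∧ dist x y ≤ t := hy
        rw [mem_closedBall, dist_comm]; exact hy.2
    _ = _ := by rw [← ENNReal.ofReal_mul (by positivity)]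

def cerr (n C α a c : ℝ) : ℝ := C * (4 * c * a ^ (2 * n)) + C * c * 40 ^ n + c * 5 ^ n * cfar n C α

theorem cotlar_pointwise (hK : IsCZKernel K n C α) (hn : 0 < n) (hC : 0 < C) (hα : 0 < α)
    (hα1 : α ≤ 1) {a b c τ : ℝ} (ha : 40 ≤ a) (hb : 2 * a ^ n ≤ b) (hc : 0 < c) (hτ : 0 < τ)
    (σ ρ : Measure (Pt d)) [IsFiniteMeasure ρ] {g : Pt d → ℂ}
    (hg : Measurable g) (hg1 : ∀ x, ‖g x‖ ≤ 1)
    (hσ : ∀ x r, 0 < r → σ (closedBall x r) ≤ ENNReal.ofReal (c * r ^ n))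
    {ε r : ℝ} (hε : 0 < ε) (hr : ε ≤ r) (x : Pt d) (k : ℕ)
    (hnd : ∀ j < k, ENNReal.ofReal b * σ (closedBall x (a ^ j * r)) ≤
      σ (closedBall x (a ^ (j+1) * r)))
    (hρ : ∀ s, 0 < s → ρ (closedBall x s) ≤ ENNReal.ofReal τ * σ (closedBall x (5 * s)))
    (w : Pt d) (hw : dist x w ≤ a ^ k * r) :
    ‖Tr K r ρ g x‖ₑ ≤ ‖truncT ρ K ε g w‖ₑ +
      ‖truncT (ρ.restrict (closedBall x (8 * (a ^ k * r)))) K ε g w‖ₑ +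
      ENNReal.ofReal (cerr n C α a c * τ) := by
  have hr0 : 0 < r := hε.trans_le hr
  set s := a ^ k * r with hsdef
  have hrs : r ≤ s := by
    have : (1:ℝ) ≤ a ^ k := one_le_pow₀ (by linarith)
    nlinarith
  have hs0 : 0 < s := hr0.trans_le hrs
  set B := closedBall x (8 * s) with hB
  have hBm : MeasurableSet B := isClosed_closedBall.measurableSet
  have hBc : Bᶜ = {y | 8 * s < dist x y} := by
    ext y; simp [hB, dist_comm]
  have hρn : ∀ t, 0 < t → ρ (closedBall x t) ≤ ENNReal.ofReal (τ * (c * 5 ^ n) * t ^ n) := by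
    intro t ht
    refine (hρ t ht).trans ((mul_le_mul_right (hσ x (5 * t) (by positivity)) _).trans ?_)
    rw [← ENNReal.ofReal_mul hτ.le, Real.mul_rpow (by norm_num) ht.le]
    apply le_of_eq; congr 1; ring
  have hint := integrable_kr hK hn hC hα hr0 ρ hg hg1 x
  have hhard := integrableOn_hard hK hn hC hα hε ρ hg hg1 w
  have hBsub : Bᶜ ⊆ {y | ε < dist w y} := by
    rw [hBc]
    intro y (hy : 8 * s < dist x y)
    show ε < dist w y
    have := dist_triangle x w y
    linarith
  -- splitting of the hard truncation
  have e1 : truncT ρ K ε g w = truncT (ρ.restrict B) K ε g w + ∫ y in Bᶜ, K w y * g y ∂ρ := by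
    unfold truncT
    rw [Measure.restrict_restrict (measurableSet_lt measurable_const (by fun_prop))]
    have : {y | ε < dist w y} = ({y | ε < dist w y} ∩ B) ∪ Bᶜ := by
      ext y
      by_cases hy : y ∈ B
      · simp [hy]
      · have := hBsub hy
        simp [hy]; exact this
    conv_lhs => rw [this]
    refine setIntegral_union ?_ hBm.compl (hhard.mono_set inter_subset_left) (hhard.mono_set hBsub)
    exact disjoint_compl_right.mono_left inter_subset_right
  have hKx : IntegrableOn (fun y => kr K r x y * g y) Bᶜ ρ := hint.integrableOn
  have e2 : Tr K r ρ g x = ∫ y in B, kr K r x y * g y ∂ρ +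
      (∫ y in Bᶜ, (K x y - K w y) * g y ∂ρ + ∫ y in Bᶜ, K w y * g y ∂ρ) := by
    unfold Tr
    rw [← integral_add_compl hBm hint]
    congr 1
    have hdiff : ∫ y in Bᶜ, (K x y - K w y) * g y ∂ρ =
        ∫ y in Bᶜ, (kr K r x y * g y - K w y * g y) ∂ρ := by
      refine setIntegral_congr_fun hBm.compl fun y hy => ?_
      rw [hBc] at hy
      have hy : 8 * s < dist x y := hy
      rw [kr_eq K hr0 (by linarith)]; ring
    rw [hdiff, integral_sub hKx (hhard.mono_set hBsub)]
    ring
  have e3 : Tr K r ρ g x = truncT ρ K ε g w - truncT (ρ.restrict B) K ε g w +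
      (∫ y in B, kr K r x y * g y ∂ρ + ∫ y in Bᶜ, (K x y - K w y) * g y ∂ρ) := by
    rw [e2, e1]; ring
  have hfar : ‖∫ y in Bᶜ, (K x y - K w y) * g y ∂ρ‖ₑ ≤
      ENNReal.ofReal (τ * (c * 5 ^ n) * cfar n C α) := by
    refine (enorm_integral_le_kernel hg1).trans ?_
    rw [hBc]
    exact far_compare hn hC hα hα1 K (fun p q y hpy h => K_smooth5 hK hC hpy h) ρ x x w hs0
      (by positivity) (by simp [hs0.le]) hw (fun t ht => hρn t (hs0.trans_le ht))
  have hnear : ‖∫ y in B, kr K r x y * g y ∂ρ‖ₑ ≤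
      ENNReal.ofReal (C * (τ * (4 * c * a ^ (2 * n)))) +
        ENNReal.ofReal (C / s ^ n * (τ * (c * 5 ^ n) * (8 * s) ^ n)) := by
    refine (enorm_integral_le_kernel hg1).trans ?_
    have hsub : B ⊆ {y | dist x y ≤ r} ∪ ({y | r < dist x y ∧ dist x y ≤ s} ∪
        {y | s < dist x y ∧ dist x y ≤ 8 * s}) := by
      intro y hy
      have hy : dist x y ≤ 8 * s := by simpa [hB, dist_comm] using hy
      simp only [mem_union, mem_ofPred_eq]
      rcases le_or_gt (dist x y) r with h | h
      · exact Or.inl h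
      · rcases le_or_gt (dist x y) s with h' | h'
        · exact Or.inr (Or.inl ⟨h, h'⟩)
        · exact Or.inr (Or.inr ⟨h', hy⟩)
    refine (lintegral_mono_set hsub).trans ((lintegral_union_le _ _ _).trans ?_)
    have hz : ∫⁻ y in {y | dist x y ≤ r}, ‖kr K r x y‖ₑ ∂ρ = 0 := by
      rw [setLIntegral_congr_fun (g := fun _ => 0)
        (measurableSet_le (by fun_prop) measurable_const)]
      · simp
      · intro y hy
        have hy : dist x y ≤ r := hy
        simp [kr_zero K hr0 hy]
    rw [hz, zero_add]
    refine (lintegral_union_le _ _ _).trans (add_le_add ?_ ?_)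
    · have hm : MeasurableSet {y : Pt d | r < dist x y ∧ dist x y ≤ s} :=
        meas_ann x r s
      calc _ ≤ ∫⁻ y in {y | r < dist x y ∧ dist x y ≤ s},
              ENNReal.ofReal C * ENNReal.ofReal (1 / dist x y ^ n) ∂ρ := by
            refine setLIntegral_mono' hm fun y hy => ?_
            have hy : r < dist x y ∧ dist x y ≤ s := hy
            rw [← ENNReal.ofReal_mul hC.le, ← ofReal_norm]
            apply ENNReal.ofReal_le_ofReal
            rw [mul_one_div]
            exact (norm_kr_le_K K r x y).trans (hK.size x y (dist_pos.1 (hr0.trans hy.1)))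
        _ = ENNReal.ofReal C * ∫⁻ y in {y | r < dist x y ∧ dist x y ≤ s},
              ENNReal.ofReal (1 / dist x y ^ n) ∂ρ := lintegral_const_mul' _ _ ENNReal.ofReal_ne_top
        _ ≤ ENNReal.ofReal C * ENNReal.ofReal (τ * (4 * c * a ^ (2 * n))) := by
            gcongr
            refine chain_integral hn (by linarith) hb hc.le hτ.le hr0 σ ρ x k (hσ x)
              (fun j _ hj => hnd j hj) ?_
            intro j _
            have hjp : 0 < a ^ j * r := by
              have : (0:ℝ) < a := by linarith
              positivity
            refine (hρ _ hjp).trans ?_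
            refine mul_le_mul_right (measure_mono (closedBall_subset_closedBall ?_)) _
            rw [pow_succ]
            nlinarith
        _ = _ := by rw [← ENNReal.ofReal_mul hC.le]
    · exact near_bound hK hn hC ρ x hs0 (hρn _ (by positivity)) _ (fun y => norm_kr_le_K K r x y)
  rw [e3]
  have hsum : ‖∫ y in B, kr K r x y * g y ∂ρ + ∫ y in Bᶜ, (K x y - K w y) * g y ∂ρ‖ₑ ≤
      ENNReal.ofReal (cerr n C α a c * τ) := by
    refine (enorm_add_le _ _).trans ((add_le_add hnear hfar).trans ?_)
    have ha0 : 0 < a := by linarith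
    have := cfar_pos (n := n) hC hα
    rw [← ENNReal.ofReal_add (by positivity) (by positivity),
      ← ENNReal.ofReal_add (by positivity) (by positivity)]
    apply ENNReal.ofReal_le_ofReal
    have e40 : (40:ℝ) ^ n = 5 ^ n * 8 ^ n := by
      rw [← Real.mul_rpow (by norm_num) (by norm_num)]; norm_num
    rw [Real.mul_rpow (by norm_num) hs0.le]
    unfold cerr
    rw [e40]
    apply le_of_eq
    have : s ^ n ≠ 0 := by positivity
    field_simp
  refine (enorm_add_le _ _).trans (add_le_add ?_ hsum)
  exact enorm_sub_le

end GLam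

namespace GLam

variable {d : ℕ} {n C α : ℝ} {K : Pt d → Pt d → ℂ}

theorem cerr_pos {a c : ℝ} (hC : 0 < C) (hα : 0 < α) (ha : 0 < a) (hc : 0 < c) :
    0 < cerr n C α a c := by
  have := cfar_pos (n := n) hC hα
  unfold cerr; positivity

theorem e2_mul (t : ℝ) : (2:ℝ≥0∞) * ENNReal.ofReal t = ENNReal.ofReal (2 * t) := by
  rw [ENNReal.ofReal_mul (by norm_num)]; simp

def kap (n C α a b c A : ℝ) : ℝ := 1 / (2 * cerr n C α a c + 8 * A * b)
def Acot (n C α a b c A : ℝ) : ℝ := 1 / kap n C α a b c A + 8 * b * A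

/-- Weak type transfers from uniform truncations to the maximal smooth truncation. -/
theorem cotlar (hK : IsCZKernel K n C α) (hn : 0 < n) (hC : 0 < C) (hα : 0 < α)
    (hα1 : α ≤ 1) {a b c A : ℝ} (ha : 40 ≤ a) (hb : 2 * a ^ n ≤ b) (hc : 0 < c) (hA : 0 < A)
    (σ : Measure (Pt d)) [IsFiniteMeasure σ]
    (hσ : ∀ x r, 0 < r → σ (closedBall x r) ≤ ENNReal.ofReal (c * r ^ n))
    {ε : ℝ} (hε : 0 < ε) {g : Pt d → ℂ} (hg : Measurable g) (hg1 : ∀ x, ‖g x‖ ≤ 1)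
    (hT : ∀ ρ : Measure (Pt d), IsFiniteMeasure ρ → ∀ lam : ℝ, 0 < lam →
      ENNReal.ofReal lam * σ {x | ENNReal.ofReal lam < ‖truncT ρ K ε g x‖ₑ}
        ≤ ENNReal.ofReal A * ρ univ)
    (ρ : Measure (Pt d)) [IsFiniteMeasure ρ] {lam : ℝ} (hl : 0 < lam) :
    ENNReal.ofReal lam * σ {x | ENNReal.ofReal lam < Ns K ε ρ g x}
      ≤ ENNReal.ofReal (Acot n C α a b c A) * ρ univ := by
  have ha0 : 0 < a := by linarith
  have han1 : 1 ≤ a ^ n := Real.one_le_rpow (by linarith) hn.le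
  have hb2 : 2 ≤ b := by linarith
  have hb0 : 0 < b := by linarith
  have hce := cerr_pos (n := n) hC hα ha0 hc
  have hden : 0 < 2 * cerr n C α a c + 8 * A * b := by positivity
  set κ := kap n C α a b c A with hκ
  have hκ0 : 0 < κ := by rw [hκ, kap]; positivity
  have hκ' : κ * (2 * cerr n C α a c + 8 * A * b) = 1 := by
    rw [hκ, kap]; field_simp
  have hκ1 : cerr n C α a c * κ ≤ 1 / 2 := by
    have : 0 < κ * (8 * A * b) := by positivity
    nlinarith
  have hκ2 : 4 * A * κ * b ≤ 1 / 2 := by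
    have : 0 < κ * (2 * cerr n C α a c) := by positivity
    nlinarith
  set τ := κ * lam with hτ
  have hτ0 : 0 < τ := by positivity
  set F := toMeasurable σ {x | ENNReal.ofReal (lam / 4) < ‖truncT ρ K ε g x‖ₑ} with hF
  have hFm : MeasurableSet F := measurableSet_toMeasurable _ _
  have hFσ : ENNReal.ofReal (lam / 4) * σ F ≤ ENNReal.ofReal A * ρ univ := by
    rw [hF, measure_toMeasurable]; exact hT ρ inferInstance (lam / 4) (by positivity)
  set Bad := {x | ∃ r, 0 < r ∧ ENNReal.ofReal τ * σ (closedBall x (5 * r)) < ρ (closedBall x r)}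
    with hBad
  have hBadσ : σ Bad ≤ (ENNReal.ofReal τ)⁻¹ * ρ univ := by
    refine vitali_univ σ ρ _ _ ?_
    rintro x ⟨r, hr, h⟩
    refine ⟨r, hr, ?_⟩
    rw [← ENNReal.div_eq_inv_mul, ENNReal.le_div_iff_mul_le (by simp [hτ0]) (by simp), mul_comm]
    exact h.le
  set Null := {x | ∃ r, 0 < r ∧ σ (closedBall x (5 * r)) = 0} with hNull
  have hNullσ : σ Null = 0 := by
    have : σ Null ≤ 0 * σ univ := by
      refine vitali_univ σ σ _ _ ?_
      rintro x ⟨r, hr, h⟩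
      exact ⟨r, hr, by rw [h]; simp⟩
    simpa using this
  set S := {x | ENNReal.ofReal lam < Ns K ε ρ g x} with hS
  have hrest : σ (S \ (Bad ∪ Null)) ≤ ENNReal.ofReal (2 * b) * (σ.restrict F) univ := by
    refine vitali_univ σ (σ.restrict F) _ _ ?_
    rintro x ⟨hxS, hx⟩
    simp only [mem_union, not_or] at hx
    obtain ⟨hxB, hxN⟩ := hx
    have hρ : ∀ s, 0 < s → ρ (closedBall x s) ≤ ENNReal.ofReal τ * σ (closedBall x (5 * s)) := by
      intro s hs
      by_contra h
      exact hxB ⟨s, hs, not_le.1 h⟩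
    obtain ⟨r, hr, hTr⟩ := lt_Ns_iff.1 hxS
    have hr0 : 0 < r := hε.trans_le hr
    -- first doubling scale
    have hex : ∃ k : ℕ, σ (closedBall x (a ^ (k+1) * r)) ≤
        ENNReal.ofReal b * σ (closedBall x (a ^ k * r)) := by
      by_contra hcon
      push Not at hcon
      have hgrow : ∀ j : ℕ, 2 ^ j * σ (closedBall x r) ≤ σ (closedBall x (a ^ j * r)) := by
        intro j
        induction j with
        | zero => simp
        | succ j ih =>
          refine le_trans ?_ (hcon j).le
          calc 2 ^ (j+1) * σ (closedBall x r) = 2 * (2 ^ j * σ (closedBall x r)) := by ring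
            _ ≤ ENNReal.ofReal b * σ (closedBall x (a ^ j * r)) := by
              gcongr
              rw [show (2:ℝ≥0∞) = ENNReal.ofReal 2 by simp]
              exact ENNReal.ofReal_le_ofReal hb2
      have h0 : σ (closedBall x r) ≠ 0 := by
        intro h0
        exact hxN ⟨r / 5, by positivity, by rw [show 5 * (r / 5) = r by ring]; exact h0⟩
      have hfin : σ univ / σ (closedBall x r) ≠ ∞ := ENNReal.div_ne_top (measure_ne_top _ _) h0
      obtain ⟨m, hm⟩ := ENNReal.exists_nat_gt hfin
      have h1 := (hgrow m).trans (measure_mono (subset_univ _))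
      rw [← ENNReal.le_div_iff_mul_le (Or.inl h0) (Or.inl (measure_ne_top _ _))] at h1
      have h2 : (m:ℝ≥0∞) ≤ 2 ^ m := by exact_mod_cast (Nat.lt_two_pow_self (n := m)).le
      exact absurd (h2.trans h1) (not_le.2 hm)
    classical
    set k := Nat.find hex with hk
    have hdoub := Nat.find_spec hex
    have hnd : ∀ j < k, ENNReal.ofReal b * σ (closedBall x (a ^ j * r)) ≤
        σ (closedBall x (a ^ (j+1) * r)) := by
      intro j hj
      exact (not_le.1 (Nat.find_min hex hj)).le
    rw [← hk] at hdoub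
    set s := a ^ k * r with hs
    have hs0 : 0 < s := by positivity
    have has : a ^ (k+1) * r = a * s := by rw [hs, pow_succ]; ring
    rw [has] at hdoub
    set B := closedBall x (8 * s) with hB
    set H := {w | ENNReal.ofReal (lam / 4) < ‖truncT (ρ.restrict B) K ε g w‖ₑ} with hH
    have hcov : closedBall x s ⊆ (F ∩ closedBall x s) ∪ H := by
      intro w hw
      by_contra hcon
      simp only [mem_union, mem_inter_iff, hw, and_true, not_or] at hcon
      have h1 : ‖truncT ρ K ε g w‖ₑ ≤ ENNReal.ofReal (lam / 4) := by
        by_contra h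
        exact hcon.1 (subset_toMeasurable _ _ (not_le.1 h))
      have h2 : ‖truncT (ρ.restrict B) K ε g w‖ₑ ≤ ENNReal.ofReal (lam / 4) := by
        by_contra h
        exact hcon.2 (not_le.1 h)
      have h3 := cotlar_pointwise hK hn hC hα hα1 ha hb hc hτ0 σ ρ hg hg1 hσ hε hr x k hnd hρ w
        (by rw [dist_comm]; exact hw)
      have h4 := hTr.trans_le (h3.trans (add_le_add (add_le_add h1 h2) le_rfl))
      rw [← ENNReal.ofReal_add (by positivity) (by positivity),
        ← ENNReal.ofReal_add (by positivity) (by positivity)] at h4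
      have h5 := (ENNReal.ofReal_lt_ofReal_iff_of_nonneg hl.le).1 h4
      rw [hτ] at h5
      nlinarith
    have hHσ : σ H ≤ ENNReal.ofReal (1/2) * σ (closedBall x s) := by
      have h1 := hT (ρ.restrict B) inferInstance (lam / 4) (by positivity)
      rw [Measure.restrict_apply_univ] at h1
      have h2 : ρ B ≤ ENNReal.ofReal τ * (ENNReal.ofReal b * σ (closedBall x s)) := by
        refine (hρ (8 * s) (by positivity)).trans (mul_le_mul_right (le_trans ?_ hdoub) _)
        refine measure_mono (closedBall_subset_closedBall ?_)
        nlinarith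
      have h3 := h1.trans (mul_le_mul_right h2 _)
      rw [← mul_assoc, ← mul_assoc, ← ENNReal.ofReal_mul hA.le, ← ENNReal.ofReal_mul (by positivity)] at h3
      have h4 : σ H ≤ (ENNReal.ofReal (A * τ * b) * σ (closedBall x s)) / ENNReal.ofReal (lam / 4) := by
        rw [ENNReal.le_div_iff_mul_le (by simp [hl]) (by simp), mul_comm]
        exact h3
      refine h4.trans ?_
      rw [div_eq_mul_inv, mul_right_comm, ← div_eq_mul_inv, ← ENNReal.ofReal_div_of_pos (by positivity)]
      refine mul_le_mul_left (ENNReal.ofReal_le_ofReal ?_) _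
      rw [div_le_iff₀ (by positivity), hτ]
      nlinarith
    have hhalf : σ (closedBall x s) ≤ 2 * σ (F ∩ closedBall x s) := by
      have h1 := (measure_mono hcov).trans ((measure_union_le _ _).trans (add_le_add le_rfl hHσ))
      have hfin : σ (closedBall x s) ≠ ∞ := measure_ne_top _ _
      have hfin2 : σ (F ∩ closedBall x s) ≠ ∞ := measure_ne_top _ _
      rw [← ENNReal.ofReal_toReal hfin, ← ENNReal.ofReal_toReal hfin2] at h1 ⊢
      rw [← ENNReal.ofReal_mul (by norm_num), ← ENNReal.ofReal_add (by positivity) (by positivity),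
        ENNReal.ofReal_le_ofReal_iff (by positivity)] at h1
      rw [e2_mul]
      apply ENNReal.ofReal_le_ofReal
      linarith
    refine ⟨s, hs0, ?_⟩
    rw [Measure.restrict_apply isClosed_closedBall.measurableSet, inter_comm]
    calc σ (closedBall x (5 * s)) ≤ σ (closedBall x (a * s)) :=
          measure_mono (closedBall_subset_closedBall (by nlinarith))
      _ ≤ ENNReal.ofReal b * σ (closedBall x s) := hdoub
      _ ≤ ENNReal.ofReal b * (2 * σ (F ∩ closedBall x s)) := by gcongr
      _ = _ := by
          rw [ENNReal.ofReal_mul (by norm_num)]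
          simp; ring
  rw [Measure.restrict_apply_univ] at hrest
  have hSle : σ S ≤ (ENNReal.ofReal τ)⁻¹ * ρ univ + ENNReal.ofReal (2 * b) * σ F := by
    have : S ⊆ (Bad ∪ Null) ∪ (S \ (Bad ∪ Null)) := by
      intro x hx
      by_cases h : x ∈ Bad ∪ Null
      · exact Or.inl h
      · exact Or.inr ⟨hx, h⟩
    refine (measure_mono this).trans ((measure_union_le _ _).trans (add_le_add ?_ hrest))
    refine (measure_union_le _ _).trans ?_
    rw [hNullσ, add_zero]; exact hBadσ
  calc ENNReal.ofReal lam * σ S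
      ≤ ENNReal.ofReal lam * ((ENNReal.ofReal τ)⁻¹ * ρ univ + ENNReal.ofReal (2 * b) * σ F) := by
        gcongr
    _ = ENNReal.ofReal (1 / κ) * ρ univ + ENNReal.ofReal (8 * b) * (ENNReal.ofReal (lam / 4) * σ F) := by
        rw [mul_add, ← mul_assoc, ← mul_assoc, ← mul_assoc, ← ENNReal.ofReal_mul hl.le,
          ← ENNReal.ofReal_mul (by positivity), ← ENNReal.ofReal_inv_of_pos hτ0,
          ← ENNReal.ofReal_mul hl.le]
        congr 3
        · rw [hτ]; field_simp
        · ring_nf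
    _ ≤ ENNReal.ofReal (1 / κ) * ρ univ + ENNReal.ofReal (8 * b) * (ENNReal.ofReal A * ρ univ) := by
        gcongr
    _ = _ := by
        rw [← mul_assoc, ← ENNReal.ofReal_mul (by positivity), ← add_mul,
          ← ENNReal.ofReal_add (by positivity) (by positivity)]
        rfl

end GLam

namespace GLam

variable {d : ℕ}

def sn (x y : Pt d) : ℝ := ‖fun i => y i - x i‖

theorem sn_le_iff (x y : Pt d) {h : ℝ} (hh : 0 ≤ h) : sn x y ≤ h ↔ ∀ i, |y i - x i| ≤ h := by
  unfold sn
  rw [pi_norm_le_iff_of_nonneg hh]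
  simp only [Real.norm_eq_abs]

theorem sn_le_dist (x y : Pt d) : sn x y ≤ dist x y := by
  rw [sn_le_iff _ _ dist_nonneg]
  intro i
  rw [dist_comm, dist_eq_norm]
  have := PiLp.norm_apply_le (y - x) i
  simpa using this

theorem dist_le_sn (x y : Pt d) : dist x y ≤ d * sn x y := by
  have h0 : 0 ≤ sn x y := norm_nonneg _
  rcases Nat.eq_zero_or_pos d with hd | hd
  · subst hd
    have : x = y := Subsingleton.elim _ _
    simp [this]
  have hd1 : (1:ℝ) ≤ d := by exact_mod_cast hd
  rw [EuclideanSpace.dist_eq]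
  refine Real.sqrt_le_iff.2 ⟨by positivity, ?_⟩
  calc ∑ i, dist (x i) (y i) ^ 2 ≤ ∑ _i : Fin d, (sn x y) ^ 2 := by
        refine Finset.sum_le_sum fun i _ => ?_
        have := (sn_le_iff x y h0).1 le_rfl i
        rw [dist_comm, Real.dist_eq]
        gcongr
    _ = d * sn x y ^ 2 := by simp
    _ ≤ (d * sn x y) ^ 2 := by
        have : 0 ≤ sn x y ^ 2 := by positivity
        nlinarith [mul_nonneg (sub_nonneg.2 hd1) this, mul_nonneg (mul_nonneg (sub_nonneg.2 hd1) this) (by positivity : (0:ℝ) ≤ d)]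

theorem sn_sub (x y z : Pt d) : |sn x y - sn x z| ≤ dist y z := by
  have h := abs_norm_sub_norm_le (fun i => y i - x i) (fun i => z i - x i)
  refine h.trans (le_trans (le_of_eq ?_) (sn_le_dist z y |>.trans_eq (dist_comm _ _)))
  unfold sn
  congr 1
  ext i
  simp

theorem sn_cont (x : Pt d) : Continuous (sn x) := by
  unfold sn
  fun_prop

theorem cube_eq (x : Pt d) {h : ℝ} (hh : 0 ≤ h) : (Cube.toSet ⟨x, 2 * h⟩) = {y | sn x y ≤ h} := by
  ext y
  simp only [Cube.toSet, mem_ofPred_eq]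
  rw [sn_le_iff _ _ hh]
  simp

theorem cube5_eq (x : Pt d) {h : ℝ} (hh : 0 ≤ h) :
    (Cube.scale 5 ⟨x, 2 * h⟩).toSet = {y | sn x y ≤ 5 * h} := by
  have := cube_eq x (h := 5 * h) (by positivity)
  rw [← this]
  simp only [Cube.scale]
  congr 2
  ring

theorem frontier_close (hd : 0 < d) (x y : Pt d) {h t : ℝ} (hh : 0 < h)
    (hy : infDist y (frontier {y | sn x y ≤ h}) ≤ t) : |sn x y - h| ≤ t := by
  have hne : (frontier {y | sn x y ≤ h}).Nonempty := by
    have : Nonempty (Fin d) := ⟨⟨0, hd⟩⟩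
    rw [nonempty_frontier_iff]
    constructor
    · refine ⟨x, ?_⟩
      show sn x x ≤ h
      simp [sn]; exact hh.le
    · intro hu
      have hz : (x + EuclideanSpace.single ⟨0, hd⟩ (h + 1)) ∈ {y | sn x y ≤ h} := by rw [hu]; trivial
      have hz : sn x (x + EuclideanSpace.single ⟨0, hd⟩ (h + 1)) ≤ h := hz
      have := (sn_le_iff _ _ hh.le).1 hz ⟨0, hd⟩
      simp at this
      have := le_abs_self (h+1)
      linarith
  obtain ⟨z, hz, hzd⟩ := isClosed_frontier.exists_infDist_eq_dist hne y
  have hz' : sn x z = h := frontier_le_subset_eq (sn_cont x) continuous_const hz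
  rw [← hz']
  refine (sn_sub x y z).trans ?_
  rw [← hzd]; exact hy

theorem small_bdry (hd : 0 < d) (μ : Measure (Pt d)) (x : Pt d) {r a b C₁ : ℝ} (hr : 0 < r)
    (ha : 10 * d ≤ a) (hb : 0 < b) (hC1 : 40 * b < C₁)
    (hfin : μ (closedBall x (a * r)) ≠ ∞)
    (hdb : μ (closedBall x (a * r)) ≤ ENNReal.ofReal b * μ (closedBall x r)) :
    ∃ Q : Cube d, 0 < Q.side ∧ closedBall x r ⊆ Q.toSet ∧ Q.toSet ⊆ closedBall x (2 * d * r) ∧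
      (Cube.scale 5 Q).toSet ⊆ closedBall x (a * r) ∧ SmallBoundary μ C₁ Q := by
  have hd1 : (1:ℝ) ≤ d := by exact_mod_cast hd
  have hC0 : 0 < C₁ := by linarith
  have hgeo : ∀ h, r ≤ h → h ≤ 2 * r → closedBall x r ⊆ {y | sn x y ≤ h} ∧
      {y | sn x y ≤ h} ⊆ closedBall x (2 * d * r) ∧ {y | sn x y ≤ 5 * h} ⊆ closedBall x (a * r) := by
    intro h h1 h2
    refine ⟨?_, ?_, ?_⟩
    · intro y hy
      show sn x y ≤ h
      rw [mem_closedBall, dist_comm] at hy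
      exact (sn_le_dist x y).trans (hy.trans h1)
    · intro y hy
      have hy : sn x y ≤ h := hy
      rw [mem_closedBall, dist_comm]
      refine (dist_le_sn x y).trans ?_
      nlinarith
    · intro y hy
      have hy : sn x y ≤ 5 * h := hy
      rw [mem_closedBall, dist_comm]
      refine (dist_le_sn x y).trans ?_
      have : sn x y ≤ 10 * r := by linarith
      nlinarith
  have hsm : μ (closedBall x r) ≤ μ (closedBall x (a * r)) :=
    measure_mono (closedBall_subset_closedBall (by nlinarith))
  suffices H : ∃ h, r ≤ h ∧ h ≤ 2 * r ∧ ∀ lam, 0 < lam →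
      μ (closedBall x (a * r) ∩ {y | |sn x y - h| ≤ 2 * lam * h}) ≤
        ENNReal.ofReal (C₁ * lam) * μ (closedBall x r) by
    obtain ⟨h, h1, h2, hH⟩ := H
    have hh : 0 < h := by linarith
    obtain ⟨g1, g2, g3⟩ := hgeo h h1 h2
    refine ⟨⟨x, 2 * h⟩, by simpa using hh, ?_, ?_, ?_, ?_⟩
    · rw [cube_eq x hh.le]; exact g1
    · rw [cube_eq x hh.le]; exact g2
    · rw [cube5_eq x hh.le]; exact g3
    · intro lam hlam
      rw [cube_eq x hh.le, cube5_eq x hh.le]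
      refine le_trans (measure_mono ?_) ((hH lam hlam).trans (mul_le_mul_right (measure_mono (g1.trans ?_)) _))
      · rintro y ⟨hy1, hy2⟩
        refine ⟨g3 hy1, ?_⟩
        have := frontier_close hd x y hh hy2
        show |sn x y - h| ≤ 2 * lam * h
        have e : lam * (Cube.mk x (2*h)).side = 2 * lam * h := by show lam * (2 * h) = _; ring
        rw [← e]; exact this
      · intro y hy
        have hy : sn x y ≤ h := hy
        show sn x y ≤ 5 * h
        linarith
  by_cases h0 : μ (closedBall x r) = 0
  · rw [h0, mul_zero] at hdb
    refine ⟨r, le_rfl, by linarith, fun lam _ => ?_⟩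
    exact (measure_mono inter_subset_left).trans (hdb.trans zero_le)
  have hm : μ (closedBall x r) ≠ ∞ := ne_top_of_le_ne_top hfin hsm
  by_contra hcon
  push Not at hcon
  set ν := (μ.restrict (closedBall x (a * r))).map (sn x) with hν
  have key : volume (Icc r (2 * r)) ≤ (ENNReal.ofReal (40 * r) / (ENNReal.ofReal C₁ * μ (closedBall x r))) * ν univ := by
    refine vitali_univ volume ν _ _ ?_
    rintro h ⟨h1, h2⟩
    obtain ⟨lam, hl, hlt⟩ := hcon h h1 h2
    have hh : 0 < h := by linarith
    refine ⟨2 * lam * h, by positivity, ?_⟩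
    have e : ν (closedBall h (2 * lam * h)) = μ (closedBall x (a * r) ∩ {y | |sn x y - h| ≤ 2 * lam * h}) := by
      rw [hν, Measure.map_apply (sn_cont x).measurable isClosed_closedBall.measurableSet,
        Measure.restrict_apply ((sn_cont x).measurable isClosed_closedBall.measurableSet), inter_comm]
      congr 2
    rw [e, Real.volume_closedBall]
    refine le_trans ?_ (mul_le_mul_right hlt.le _)
    rw [ENNReal.ofReal_mul hC0.le, mul_right_comm (ENNReal.ofReal C₁), ← mul_assoc (_ / _), ENNReal.div_mul_cancel
      (mul_ne_zero (by simpa using hC0) h0) (ENNReal.mul_ne_top (by simp) hm), ← ENNReal.ofReal_mul (by positivity)]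
    apply ENNReal.ofReal_le_ofReal
    nlinarith
  have hνu : ν univ = μ (closedBall x (a * r)) := by
    rw [hν, Measure.map_apply (sn_cont x).measurable MeasurableSet.univ]; simp
  rw [hνu, Real.volume_Icc] at key
  have key2 := key.trans (mul_le_mul_right hdb _)
  rw [mul_comm (ENNReal.ofReal C₁), mul_comm (ENNReal.ofReal b), ← mul_assoc, mul_comm _ (μ _), ← mul_div_assoc,
    ENNReal.mul_div_mul_left _ _ h0 hm, ← ENNReal.ofReal_div_of_pos hC0,
    ← ENNReal.ofReal_mul (by positivity), ENNReal.ofReal_le_ofReal_iff (by positivity)] at key2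
  rw [div_mul_eq_mul_div, le_div_iff₀ hC0] at key2
  nlinarith

end GLam

namespace GLam

variable {d : ℕ} {n C α : ℝ} {K : Pt d → Pt d → ℂ}

theorem ae_doubling (μ : Measure (Pt d)) {a : ℝ} (ha : 5 ≤ a) (Ω : Set (Pt d)) (D : Pt d → ℝ)
    {R : ℝ} (hvol : volume Ω ≠ ∞) (hD : ∀ x ∈ Ω, 0 < D x) (hR : ∀ x ∈ Ω, D x ≤ R)
    (hsub : ∀ x ∈ Ω, closedBall x (D x) ⊆ Ω) (hfin : ∀ x r, μ (closedBall x r) ≠ ∞) :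
    μ {x ∈ Ω | ∀ j : ℕ, ENNReal.ofReal (2 * a ^ d) * μ (closedBall x (D x / a ^ j)) <
      μ (closedBall x (a * (D x / a ^ j)))} = 0 := by
  have ha0 : 0 < a := by linarith
  set S := {x ∈ Ω | ∀ j : ℕ, ENNReal.ofReal (2 * a ^ d) * μ (closedBall x (D x / a ^ j)) <
      μ (closedBall x (a * (D x / a ^ j)))} with hS
  have key : ∀ e : ℝ, 0 < e → μ S ≤ ENNReal.ofReal e * volume Ω := by
    intro e he
    refine vitali_bdd μ volume _ S Ω R ?_
    rintro x ⟨hxΩ, hx⟩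
    have hD0 := hD x hxΩ
    have hgrow : ∀ j : ℕ, ENNReal.ofReal ((2 * a ^ d) ^ j) * μ (closedBall x (D x / a ^ j)) ≤
        μ (closedBall x (D x)) := by
      intro j
      induction j with
      | zero => simp
      | succ j ih =>
        refine le_trans ?_ ih
        have h1 := (hx (j+1)).le
        have e1 : a * (D x / a ^ (j+1)) = D x / a ^ j := by
          rw [pow_succ]; field_simp
        rw [e1] at h1
        rw [pow_succ, ENNReal.ofReal_mul (by positivity), mul_assoc]
        exact mul_le_mul_right h1 _
    set M := (μ (closedBall x (D x))).toReal with hM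
    set v := (volume (ball (0 : Pt d) 1)).toReal with hv
    have hvne : volume (ball (0 : Pt d) 1) ≠ ∞ := measure_ball_lt_top.ne
    have hv0 : 0 < v := ENNReal.toReal_pos (measure_ball_pos _ _ one_pos).ne' hvne
    have hM0 : 0 ≤ M := ENNReal.toReal_nonneg
    obtain ⟨j, hj⟩ := pow_unbounded_of_one_lt (M * a ^ d / (e * v * D x ^ d)) (by norm_num : (1:ℝ) < 2)
    rw [div_lt_iff₀ (by positivity)] at hj
    have hapow : (1:ℝ) ≤ a ^ (j+1) := one_le_pow₀ (by linarith)
    have hle : D x / a ^ (j+1) ≤ D x := div_le_self hD0.le hapow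
    refine ⟨D x / a ^ (j+1), by positivity, hle.trans (hR x hxΩ),
      (closedBall_subset_closedBall hle).trans (hsub x hxΩ), ?_⟩
    have h5 : μ (closedBall x (5 * (D x / a ^ (j+1)))) ≤ μ (closedBall x (D x / a ^ j)) := by
      refine measure_mono (closedBall_subset_closedBall ?_)
      have : D x / a ^ j = a * (D x / a ^ (j+1)) := by rw [pow_succ]; field_simp
      rw [this]
      have : 0 < D x / a ^ (j+1) := by positivity
      nlinarith
    refine h5.trans ?_
    have hg := hgrow j
    rw [← ENNReal.ofReal_toReal (hfin x (D x)), ← hM, mul_comm,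
      ← ENNReal.le_div_iff_mul_le (Or.inl (by simp; positivity)) (by simp),
      ← ENNReal.ofReal_div_of_pos (by positivity)] at hg
    refine hg.trans ?_
    rw [Measure.addHaar_closedBall _ _ (by positivity), ← ENNReal.ofReal_toReal hvne, ← hv,
      finrank_euclideanSpace_fin, ← ENNReal.ofReal_mul (by positivity), ← ENNReal.ofReal_mul he.le]
    apply ENNReal.ofReal_le_ofReal
    rw [div_le_iff₀ (by positivity)]
    have e3 : e * ((D x / a ^ (j+1)) ^ d * v) * (2 * a ^ d) ^ j =
        2 ^ j * (e * v * D x ^ d) / a ^ d := by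
      rw [div_pow, mul_pow, ← pow_mul, ← pow_mul, show (j + 1) * d = d * j + d by ring, pow_add]
      field_simp
    rw [e3, le_div_iff₀ (by positivity)]
    exact hj.le
  refine le_antisymm ?_ zero_le
  have hV : volume Ω = ENNReal.ofReal (volume Ω).toReal := (ENNReal.ofReal_toReal hvol).symm
  refine ENNReal.le_of_forall_pos_le_add fun e he _ => ?_
  rw [zero_add]
  refine (key (e / ((volume Ω).toReal + 1)) (by positivity)).trans ?_
  rw [hV, ← ENNReal.ofReal_mul (by positivity), ENNReal.toReal_ofReal ENNReal.toReal_nonneg]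
  refine le_trans (ENNReal.ofReal_le_ofReal (q := e) ?_) (by simp)
  rw [div_mul_eq_mul_div, div_le_iff₀ (by positivity)]
  have : (0:ℝ) < e := he
  nlinarith

/-- integral of a kernel supported in an annulus -/
theorem near_bound' (hK : IsCZKernel K n C α) (hn : 0 < n) (hC : 0 < C) (ρ : Measure (Pt d))
    (x : Pt d) {s t : ℝ} (hs : 0 < s) {τ : ℝ} (hτ : ρ (closedBall x t) ≤ ENNReal.ofReal τ)
    (k : Pt d → ℂ) (hk : ∀ y, ‖k y‖ ≤ ‖K x y‖) (S : Set (Pt d)) (hS : MeasurableSet S)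
    (hSk : ∀ y ∈ S, k y ≠ 0 → s < dist x y ∧ dist x y ≤ t) :
    ∫⁻ y in S, ‖k y‖ₑ ∂ρ ≤ ENNReal.ofReal (C / s ^ n * τ) := by
  refine le_trans ?_ (near_bound hK hn hC ρ x hs hτ k hk)
  rw [← lintegral_indicator hS, ← lintegral_indicator (meas_ann x s t)]
  refine lintegral_mono fun y => ?_
  by_cases hy : y ∈ S
  · by_cases h0 : k y = 0
    · simp [indicator, h0]
    · rw [indicator_of_mem hy, indicator_of_mem]
      exact hSk y hy h0
  · rw [indicator_of_notMem hy]; exact zero_le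

def cloc (n C α a c : ℝ) : ℝ :=
  C * 2 ^ n * (4 * c * a ^ (2 * n)) + 2 * (C * (c * (105 * a) ^ n)) + c * 10 ^ n * cfar n C α

theorem cloc_pos {a c : ℝ} (hC : 0 < C) (hα : 0 < α) (ha : 0 < a) (hc : 0 < c) :
    0 < cloc n C α a c := by
  have := cfar_pos (n := n) hC hα
  unfold cloc; positivity

theorem local_compare (hK : IsCZKernel K n C α) (hn : 0 < n) (hC : 0 < C) (hα : 0 < α)
    (hα1 : α ≤ 1) {a b c τ : ℝ} (ha : 40 ≤ a) (hb : 2 * a ^ n ≤ b) (hc : 0 < c) (hτ : 0 < τ)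
    (μ : Measure (Pt d))
    (hμ : ∀ x r, 0 < r → μ (closedBall x r) ≤ ENNReal.ofReal (c * r ^ n))
    {ε : ℝ} (hε : 0 < ε) {g : Pt d → ℂ} (hg : Measurable g) (hg1 : ∀ x, ‖g x‖ ≤ 1)
    (ρ : Measure (Pt d)) [IsFiniteMeasure ρ] (x z z0 : Pt d) {s cc : ℝ} (hs : 0 < s) (k : ℕ)
    (hcc : 1 ≤ cc) (hcca : 20 * cc ≤ a)
    (hnd : ∀ j, 1 ≤ j → j ≤ k → ENNReal.ofReal b * μ (closedBall x (a ^ j * s)) ≤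
      μ (closedBall x (a ^ (j+1) * s)))
    (hz : dist x z ≤ cc * s)
    (hP : ∀ t, 0 < t → ρ (closedBall z t) ≤ ENNReal.ofReal τ * μ (closedBall z (5 * t)))
    (hz0 : dist x z0 ≤ 2 * (a * (a ^ k * s))) {r : ℝ} (hr : ε ≤ r) :
    ‖Tr K r ρ g z‖ₑ ≤ Ns K ε (ρ.restrict (closedBall x (2 * cc * s))) g z +
      ENNReal.ofReal (cloc n C α a c * τ) + Ns K ε ρ g z0 := by
  have ha0 : 0 < a := by linarith
  have hr0 : 0 < r := hε.trans_le hr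
  set D := a ^ k * s with hD
  have hak : 1 ≤ a ^ k := one_le_pow₀ (by linarith)
  have hsD : s ≤ D := by rw [hD]; nlinarith
  have hD0 : 0 < D := by positivity
  set B := closedBall x (2 * cc * s) with hB
  have hBm : MeasurableSet B := isClosed_closedBall.measurableSet
  set r' := max r D with hr'
  have hr'0 : 0 < r' := lt_max_of_lt_left hr0
  have hcsD : 20 * (cc * s) ≤ a * D := by
    have : cc * s ≤ cc * D := by gcongr
    nlinarith
  have hccs : s ≤ cc * s := by nlinarith
  have hρz : ∀ t, 0 < t → ρ (closedBall z t) ≤ ENNReal.ofReal (τ * (c * (5 * t) ^ n)) := by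
    intro t ht
    refine (hP t ht).trans ?_
    rw [ENNReal.ofReal_mul hτ.le]
    exact mul_le_mul_right (hμ _ _ (by positivity)) _
  set F := {y | 8 * (2 * (a * D)) < dist x y} with hF
  have hFm : MeasurableSet F := measurableSet_lt measurable_const (by fun_prop)
  have hint := integrable_kr hK hn hC hα hr0 ρ hg hg1 z
  have hint' := integrable_kr hK hn hC hα hr'0 ρ hg hg1 z
  have hint0 := integrable_kr hK hn hC hα hr'0 ρ hg hg1 z0
  have hzD : dist x z ≤ a * D := by nlinarith
  set N := Bᶜ \ F with hN
  have hNm : MeasurableSet N := hBm.compl.diff hFm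
  have hFB : F ⊆ Bᶜ := by
    intro y hy hy'
    have hy : 8 * (2 * (a * D)) < dist x y := hy
    rw [hB, mem_closedBall, dist_comm] at hy'
    nlinarith
  have e1 : Tr K r ρ g z = Tr K r (ρ.restrict B) g z + (∫ y in N, kr K r z y * g y ∂ρ
      + ∫ y in F, kr K r z y * g y ∂ρ) := by
    unfold Tr
    rw [← integral_add_compl hBm hint]
    congr 1
    have : Bᶜ = N ∪ F := by rw [hN, sdiff_union_of_subset hFB]
    rw [this, setIntegral_union disjoint_sdiff_left hFm hint.integrableOn hint.integrableOn]
  have e2 : ∫ y in F, kr K r z y * g y ∂ρ = ∫ y in F, kr K r' z y * g y ∂ρ := by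
    refine setIntegral_congr_fun hFm fun y hy => ?_
    have hy : 8 * (2 * (a * D)) < dist x y := hy
    have hzy : 15 * (a * D) ≤ dist z y := by
      have := dist_triangle x z y; linarith
    have hzy2 : 2 * D ≤ dist z y := by nlinarith
    show kr K r z y * g y = kr K r' z y * g y
    congr 1
    rcases le_total D r with h | h
    · rw [hr', max_eq_left h]
    · rw [hr', max_eq_right h, kr_eq K hr0 (by linarith), kr_eq K hD0 hzy2]
  have e3 : ∫ y in F, kr K r' z0 y * g y ∂ρ = Tr K r' ρ g z0 - ∫ y in Fᶜ, kr K r' z0 y * g y ∂ρ := by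
    unfold Tr
    rw [← integral_add_compl hFm hint0]; ring
  have e4 : Tr K r ρ g z = Tr K r (ρ.restrict B) g z + (∫ y in N, kr K r z y * g y ∂ρ
      + ∫ y in F, (kr K r' z y - kr K r' z0 y) * g y ∂ρ - ∫ y in Fᶜ, kr K r' z0 y * g y ∂ρ)
      + Tr K r' ρ g z0 := by
    have : ∫ y in F, (kr K r' z y - kr K r' z0 y) * g y ∂ρ =
        ∫ y in F, kr K r' z y * g y ∂ρ - ∫ y in F, kr K r' z0 y * g y ∂ρ := by
      rw [← integral_sub hint'.integrableOn hint0.integrableOn]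
      congr 1; ext y; ring
    rw [this, e1, e2, e3]; ring
  have b1 : ‖∫ y in F, (kr K r' z y - kr K r' z0 y) * g y ∂ρ‖ₑ ≤
      ENNReal.ofReal (τ * (c * 10 ^ n) * cfar n C α) := by
    refine (enorm_integral_le_kernel hg1).trans ?_
    refine far_compare hn hC hα hα1 (kr K r') (fun p q y hpy h => kr_smooth hK hC hα hα1 hr'0 hpy h)
      ρ x z z0 (by positivity) (by positivity) (by linarith [mul_pos ha0 hD0]) hz0 ?_
    intro t ht
    have ht0 : 0 < t := lt_of_lt_of_le (by positivity) ht
    refine (measure_mono (closedBall_subset_closedBall' (ε₂ := 2 * t) (y := z) ?_)).trans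
      ((hρz (2 * t) (by positivity)).trans (le_of_eq ?_))
    · nlinarith
    · rw [show 5 * (2 * t) = 10 * t by ring, Real.mul_rpow (by norm_num) ht0.le]
      congr 1; ring
  have h21 : ρ (closedBall z (21 * (a * D))) ≤ ENNReal.ofReal (τ * (c * (105 * a) ^ n) * D ^ n) := by
    refine (hρz _ (by positivity)).trans (le_of_eq ?_)
    rw [show 5 * (21 * (a * D)) = (105 * a) * D by ring, Real.mul_rpow (by positivity) hD0.le]
    congr 1; ring
  have b2 : ‖∫ y in Fᶜ, kr K r' z0 y * g y ∂ρ‖ₑ ≤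
      ENNReal.ofReal (C / D ^ n * (τ * (c * (105 * a) ^ n) * D ^ n)) := by
    refine (enorm_integral_le_kernel hg1).trans ?_
    refine near_bound' hK hn hC ρ z0 (t := 18 * (a * D)) hD0 ?_ _ (fun y => norm_kr_le_K K r' z0 y) _ hFm.compl ?_
    · refine (measure_mono (closedBall_subset_closedBall' ?_)).trans h21
      have := dist_triangle_left z0 z x
      linarith
    · intro y hy h0
      have hy : ¬ (8 * (2 * (a * D)) < dist x y) := hy
      constructor
      · by_contra h
        exact h0 (kr_zero K hr'0 ((not_lt.1 h).trans (le_max_right _ _)))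
      · have := dist_triangle_left z0 y x
        linarith
  have b3 : ‖∫ y in N, kr K r z y * g y ∂ρ‖ₑ ≤
      ENNReal.ofReal (C * 2 ^ n * (τ * (4 * c * a ^ (2 * n)))) +
      ENNReal.ofReal (C / D ^ n * (τ * (c * (105 * a) ^ n) * D ^ n)) := by
    refine (enorm_integral_le_kernel hg1).trans ?_
    have hsub : N ⊆ (N ∩ {y | s < dist x y ∧ dist x y ≤ a ^ (k+1) * s}) ∪ (N \ {y | dist x y ≤ a * D}) := by
      rintro y hy
      have h2 : y ∉ B := hy.1
      rw [hB, mem_closedBall, not_le, dist_comm] at h2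
      have e : a ^ (k+1) * s = a * D := by rw [hD, pow_succ]; ring
      by_cases h : dist x y ≤ a * D
      · left
        refine ⟨hy, ?_, ?_⟩
        · nlinarith
        · rw [e]; exact h
      · exact Or.inr ⟨hy, h⟩
    refine (lintegral_mono_set hsub).trans ((lintegral_union_le _ _ _).trans (add_le_add ?_ ?_))
    · calc _ ≤ ∫⁻ y in N ∩ {y | s < dist x y ∧ dist x y ≤ a ^ (k+1) * s},
              ENNReal.ofReal (C * 2 ^ n) * ENNReal.ofReal (1 / dist x y ^ n) ∂ρ := by
            refine setLIntegral_mono' (hNm.inter (meas_ann x _ _)) fun y hy => ?_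
            have h2 : y ∉ B := hy.1.1
            rw [hB, mem_closedBall, not_le, dist_comm] at h2
            have hxy : 0 < dist x y := lt_trans (by positivity) h2
            have hzy : dist x y / 2 ≤ dist z y := by
              have := dist_triangle x z y
              nlinarith
            have hzy0 : 0 < dist z y := by linarith
            rw [← ENNReal.ofReal_mul (by positivity), ← ofReal_norm]
            apply ENNReal.ofReal_le_ofReal
            refine ((norm_kr_le_K K r z y).trans (hK.size z y (dist_pos.1 hzy0))).trans ?_
            calc C / dist z y ^ n ≤ C / (dist x y / 2) ^ n := by gcongr
              _ = _ := by
                rw [Real.div_rpow hxy.le (by norm_num)]; field_simp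
        _ ≤ ∫⁻ y in {y | s < dist x y ∧ dist x y ≤ a ^ (k+1) * s},
              ENNReal.ofReal (C * 2 ^ n) * ENNReal.ofReal (1 / dist x y ^ n) ∂ρ :=
            lintegral_mono_set inter_subset_right
        _ = ENNReal.ofReal (C * 2 ^ n) * ∫⁻ y in {y | s < dist x y ∧ dist x y ≤ a ^ (k+1) * s},
              ENNReal.ofReal (1 / dist x y ^ n) ∂ρ := lintegral_const_mul' _ _ ENNReal.ofReal_ne_top
        _ ≤ ENNReal.ofReal (C * 2 ^ n) * ENNReal.ofReal (τ * (4 * c * a ^ (2 * n))) := by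
            gcongr
            refine chain_integral hn (by linarith) hb hc.le hτ.le hs μ ρ x (k+1) (hμ x)
              (fun j h1 hj => hnd j h1 (by omega)) ?_
            intro j hj
            have haj : a ≤ a ^ j := by
              calc a = a ^ 1 := (pow_one a).symm
                _ ≤ a ^ j := pow_le_pow_right₀ (by linarith) hj
            have hjs : 20 * (cc * s) ≤ a ^ j * s := by nlinarith
            have hjp : 0 < a ^ j * s := by positivity
            refine (measure_mono (closedBall_subset_closedBall' (ε₂ := a ^ j * s + cc * s) (y := z) (by linarith))).trans
              ((hP _ (by positivity)).trans (mul_le_mul_right (measure_mono (closedBall_subset_closedBall' ?_)) _))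
            rw [dist_comm z x, pow_succ]
            nlinarith
        _ = _ := by rw [← ENNReal.ofReal_mul (by positivity)]
    · refine near_bound' hK hn hC ρ z (t := 21 * (a * D)) hD0 h21 _ (fun y => norm_kr_le_K K r z y) _
        (hNm.diff (measurableSet_le (by fun_prop) measurable_const)) ?_
      rintro y ⟨hy1, hy2⟩ -
      have hy2 : ¬ (dist x y ≤ a * D) := hy2
      have hy3 : ¬ (8 * (2 * (a * D)) < dist x y) := hy1.2
      constructor
      · have := dist_triangle x z y
        nlinarith
      · have := dist_triangle_left z y x
        linarith
  have bsum : ‖∫ y in N, kr K r z y * g y ∂ρ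
      + ∫ y in F, (kr K r' z y - kr K r' z0 y) * g y ∂ρ - ∫ y in Fᶜ, kr K r' z0 y * g y ∂ρ‖ₑ ≤
      ENNReal.ofReal (cloc n C α a c * τ) := by
    refine enorm_sub_le.trans ((add_le_add ((enorm_add_le _ _).trans (add_le_add b3 b1)) b2).trans ?_)
    have := cfar_pos (n := n) hC hα
    rw [← ENNReal.ofReal_add (by positivity) (by positivity),
      ← ENNReal.ofReal_add (by positivity) (by positivity),
      ← ENNReal.ofReal_add (by positivity) (by positivity)]
    apply ENNReal.ofReal_le_ofReal
    unfold cloc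
    apply le_of_eq
    have : D ^ n ≠ 0 := by positivity
    field_simp
    ring
  rw [e4]
  refine (enorm_add_le _ _).trans (add_le_add ((enorm_add_le _ _).trans (add_le_add ?_ bsum)) ?_)
  · exact le_iSup₂_of_le r hr le_rfl
  · exact le_iSup₂_of_le r' (hr.trans (le_max_left _ _)) le_rfl

end GLam

namespace GLam

variable {d : ℕ} {n C α : ℝ} {K : Pt d → Pt d → ℂ}

theorem Acot_pos {a b c A : ℝ} (hC : 0 < C) (hα : 0 < α) (ha : 0 < a) (hc : 0 < c) (hb : 0 < b)
    (hA : 0 < A) : 0 < Acot n C α a b c A := by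
  have := cerr_pos (n := n) hC hα ha hc
  unfold Acot kap; positivity

theorem Ns_decay (hK : IsCZKernel K n C α) (hn : 0 < n) (hC : 0 < C) {R : ℝ} (hR : 0 < R)
    (ρ : Measure (Pt d)) (hρ : ρ (closedBall 0 R)ᶜ = 0) {ε : ℝ} {g : Pt d → ℂ}
    (hg1 : ∀ x, ‖g x‖ ≤ 1) {x : Pt d} (hx : 2 * R ≤ ‖x‖) :
    Ns K ε ρ g x ≤ ENNReal.ofReal (C * 2 ^ n / ‖x‖ ^ n) * ρ univ := by
  refine iSup₂_le fun r _ => ?_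
  have hx0 : 0 < ‖x‖ := by linarith
  unfold Tr
  rw [← setIntegral_univ]
  refine (enorm_integral_le_kernel hg1).trans ?_
  calc ∫⁻ y in univ, ‖kr K r x y‖ₑ ∂ρ ≤ ∫⁻ y in univ, ENNReal.ofReal (C * 2 ^ n / ‖x‖ ^ n) ∂ρ := by
        rw [Measure.restrict_univ]
        refine lintegral_mono_ae ?_
        have : ∀ᵐ y ∂ρ, y ∈ closedBall (0 : Pt d) R := by
          rw [ae_iff]; exact hρ
        filter_upwards [this] with y hy
        rw [mem_closedBall, dist_zero_right] at hy
        have hxy : ‖x‖ / 2 ≤ dist x y := by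
          rw [dist_eq_norm]
          have := norm_sub_norm_le x y
          linarith
        have hxy0 : 0 < dist x y := by linarith
        rw [← ofReal_norm]
        apply ENNReal.ofReal_le_ofReal
        refine ((norm_kr_le_K K r x y).trans (hK.size x y (dist_pos.1 hxy0))).trans ?_
        calc C / dist x y ^ n ≤ C / (‖x‖ / 2) ^ n := by gcongr
          _ = _ := by
            rw [Real.div_rpow hx0.le (by norm_num)]; field_simp
    _ = _ := by simp

theorem Ns_bdd (hK : IsCZKernel K n C α) (hn : 0 < n) (hC : 0 < C)
    (ρ : Measure (Pt d)) {ε : ℝ} (hε : 0 < ε) {g : Pt d → ℂ}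
    (hg1 : ∀ x, ‖g x‖ ≤ 1) (x : Pt d) :
    Ns K ε ρ g x ≤ ENNReal.ofReal (C / ε ^ n) * ρ univ := by
  refine iSup₂_le fun r hr => ?_
  unfold Tr
  rw [← setIntegral_univ]
  refine (enorm_integral_le_kernel hg1).trans ?_
  calc ∫⁻ y in univ, ‖kr K r x y‖ₑ ∂ρ ≤ ∫⁻ y in univ, ENNReal.ofReal (C / ε ^ n) ∂ρ := by
        refine lintegral_mono fun y => ?_
        rw [← ofReal_norm]
        apply ENNReal.ofReal_le_ofReal
        refine (norm_kr_le_const hK hn hC (hε.trans_le hr) x y).trans ?_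
        gcongr
    _ = _ := by simp

/-- big pieces hypothesis in terms of doubling balls -/
def BigPiece (μ : Measure (Pt d)) (K : Pt d → Pt d → ℂ) (a b cc θ A : ℝ) : Prop :=
  ∀ (x : Pt d) (s : ℝ), 0 < s → μ (closedBall x (a * s)) ≤ ENNReal.ofReal b * μ (closedBall x s) →
    ∃ G : Set (Pt d), MeasurableSet G ∧ G ⊆ closedBall x (cc * s) ∧
      ENNReal.ofReal θ * μ (closedBall x s) ≤ μ G ∧
      ∀ ρ : Measure (Pt d), IsFiniteMeasure ρ → ∀ g : Pt d → ℂ, (∀ x, ‖g x‖ ≤ 1) →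
        ∀ ε : ℝ, 0 < ε → ∀ lam : ℝ, 0 < lam →
          ENNReal.ofReal lam * (μ.restrict G) {x | ENNReal.ofReal lam < ‖truncT ρ K ε g x‖ₑ}
            ≤ ENNReal.ofReal A * ρ univ

def PP (μ ρ : Measure (Pt d)) (τ : ℝ) (z : Pt d) : Prop :=
  ∀ t, 0 < t → ρ (closedBall z t) ≤ ENNReal.ofReal τ * μ (closedBall z (5 * t))

theorem piece_bound (hK : IsCZKernel K n C α) (hn : 0 < n) (hC : 0 < C) (hα : 0 < α)
    (hα1 : α ≤ 1) {a b c A : ℝ} (ha : 40 ≤ a) (hb : 2 * a ^ n ≤ b) (hc : 0 < c) (hA : 0 < A)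
    (μ : Measure (Pt d))
    (hμ : ∀ x r, 0 < r → μ (closedBall x r) ≤ ENNReal.ofReal (c * r ^ n))
    {ε : ℝ} (hε : 0 < ε) {g : Pt d → ℂ} (hg : Measurable g) (hg1 : ∀ x, ‖g x‖ ≤ 1)
    (ρ : Measure (Pt d)) [IsFiniteMeasure ρ] (x z0 : Pt d) {s cc : ℝ} (hs : 0 < s) (k : ℕ)
    (hcc : 1 ≤ cc) (hcca : 20 * cc ≤ a)
    (hdoub : μ (closedBall x (a * s)) ≤ ENNReal.ofReal b * μ (closedBall x s))
    (hnd : ∀ j, 1 ≤ j → j ≤ k → ENNReal.ofReal b * μ (closedBall x (a ^ j * s)) ≤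
      μ (closedBall x (a ^ (j+1) * s)))
    (hz0 : dist x z0 ≤ 2 * (a * (a ^ k * s)))
    {G : Set (Pt d)} (hGm : MeasurableSet G) (hGs : G ⊆ closedBall x (cc * s))
    (hT : ∀ ρ : Measure (Pt d), IsFiniteMeasure ρ → ∀ lam : ℝ, 0 < lam →
      ENNReal.ofReal lam * (μ.restrict G) {x | ENNReal.ofReal lam < ‖truncT ρ K ε g x‖ₑ}
        ≤ ENNReal.ofReal A * ρ univ)
    {lam η δ : ℝ} (hl : 0 < lam) (hη : 0 < η) (hδ : 0 < δ)
    (hδ1 : cloc n C α a c * δ ≤ η / 2) (hN0 : Ns K ε ρ g z0 ≤ ENNReal.ofReal lam) :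
    μ ({z | ENNReal.ofReal ((1 + η) * lam) < Ns K ε ρ g z ∧ PP μ ρ (δ * lam) z} ∩ G) ≤
      ENNReal.ofReal (2 * Acot n C α a b c A * δ * b / η) * μ (closedBall x s) := by
  set E := {z | ENNReal.ofReal ((1 + η) * lam) < Ns K ε ρ g z ∧ PP μ ρ (δ * lam) z} with hE
  have ha0 : 0 < a := by linarith
  have hb0 : 0 < b := by
    have : 0 < a ^ n := by positivity
    linarith
  have hAc := Acot_pos (n := n) hC hα ha0 hc hb0 hA
  rcases (E ∩ G).eq_empty_or_nonempty with he | ⟨w, hwE, hwG⟩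
  · rw [he]; simp
  set B := closedBall x (2 * cc * s) with hB
  have hρB : ρ B ≤ ENNReal.ofReal (δ * lam) * (ENNReal.ofReal b * μ (closedBall x s)) := by
    have hw := hGs hwG
    rw [mem_closedBall, dist_comm] at hw
    have h2 : 0 < cc * s := by positivity
    refine (measure_mono (closedBall_subset_closedBall' (ε₂ := 3 * (cc * s)) (y := w) (by linarith))).trans
      ((hwE.2 _ (by positivity)).trans (mul_le_mul_right (le_trans
        (measure_mono (closedBall_subset_closedBall' ?_)) hdoub) _))
    rw [dist_comm]
    nlinarith
  have hfinG : IsFiniteMeasure (μ.restrict G) := by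
    refine ⟨?_⟩
    rw [Measure.restrict_apply_univ]
    exact lt_of_le_of_lt ((measure_mono hGs).trans (hμ x _ (by positivity))) ENNReal.ofReal_lt_top
  have hsub : E ∩ G ⊆ {z | ENNReal.ofReal (η * lam / 2) < Ns K ε (ρ.restrict B) g z} ∩ G := by
    rintro z ⟨⟨hz1, hz2⟩, hzG⟩
    refine ⟨?_, hzG⟩
    obtain ⟨r, hr, hlt⟩ := lt_Ns_iff.1 hz1
    have hzd := hGs hzG
    rw [mem_closedBall, dist_comm] at hzd
    have h := local_compare hK hn hC hα hα1 ha hb hc (by positivity : 0 < δ * lam) μ hμ hε hg hg1 ρ x z z0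
      hs k hcc hcca hnd hzd hz2 hz0 hr
    show ENNReal.ofReal (η * lam / 2) < Ns K ε (ρ.restrict B) g z
    by_contra hcon
    rw [not_lt] at hcon
    have h2 := hlt.trans_le (h.trans (add_le_add (add_le_add hcon (ENNReal.ofReal_le_ofReal
      (q := η * lam / 2) (by nlinarith))) hN0))
    rw [← ENNReal.ofReal_add (by positivity) (by positivity),
      ← ENNReal.ofReal_add (by positivity) (by positivity),
      ENNReal.ofReal_lt_ofReal_iff (by positivity)] at h2
    nlinarith
  refine (measure_mono hsub).trans ?_
  have hcot := cotlar hK hn hC hα hα1 ha hb hc hA (μ.restrict G)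
    (fun y r hr => (Measure.restrict_apply_le _ _).trans (hμ y r hr)) hε hg hg1 hT (ρ.restrict B)
    (lam := η * lam / 2) (by positivity)
  rw [Measure.restrict_apply' hGm, Measure.restrict_apply_univ] at hcot
  have h3 := hcot.trans (mul_le_mul_right hρB _)
  rw [← mul_assoc, ← mul_assoc, ← ENNReal.ofReal_mul hAc.le, ← ENNReal.ofReal_mul (by positivity)] at h3
  have h4 := (ENNReal.le_div_iff_mul_le (Or.inl (by simp; positivity)) (Or.inl (by simp))).2
    ((mul_comm _ _).trans_le h3)
  refine h4.trans (le_of_eq ?_)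
  rw [div_eq_mul_inv, mul_right_comm, ← div_eq_mul_inv, ← ENNReal.ofReal_div_of_pos (by positivity)]
  congr 2
  field_simp

theorem good_lambda (hd : 0 < d) (hK : IsCZKernel K n C α) (hn : 0 < n) (hC : 0 < C) (hα : 0 < α)
    (hα1 : α ≤ 1) {a b c A θ cc : ℝ} (ha : 40 ≤ a) (hb : 2 * a ^ n ≤ b) (hbd : b = 2 * a ^ d)
    (hc : 0 < c) (hA : 0 < A) (hθ : 0 < θ)
    (μ : Measure (Pt d))
    (hμ : ∀ x r, 0 < r → μ (closedBall x r) ≤ ENNReal.ofReal (c * r ^ n))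
    (hcc : 1 ≤ cc) (hcca : 20 * cc ≤ a) (hBP : BigPiece μ K a b cc θ A)
    {ε : ℝ} (hε : 0 < ε) {g : Pt d → ℂ} (hg : Measurable g) (hg1 : ∀ x, ‖g x‖ ≤ 1)
    (ρ : Measure (Pt d)) [IsFiniteMeasure ρ] {R : ℝ} (hR : 0 < R) (hρ : ρ (closedBall 0 R)ᶜ = 0)
    {lam η δ : ℝ} (hl : 0 < lam) (hη : 0 < η) (hδ : 0 < δ)
    (hδ1 : cloc n C α a c * δ ≤ η / 2) (hδ2 : 2 * Acot n C α a b c A * δ * b / η ≤ θ / (2 * b)) :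
    μ {z | ENNReal.ofReal ((1 + η) * lam) < Ns K ε ρ g z ∧ PP μ ρ (δ * lam) z} ≤
      ENNReal.ofReal (1 - θ / (2 * b)) * μ {z | ENNReal.ofReal lam < Ns K ε ρ g z} := by
  have ha0 : 0 < a := by linarith
  have hb0 : 0 < b := by rw [hbd]; positivity
  set E := {z | ENNReal.ofReal ((1 + η) * lam) < Ns K ε ρ g z ∧ PP μ ρ (δ * lam) z} with hE
  set Ω := {z | ENNReal.ofReal lam < Ns K ε ρ g z} with hΩ
  have hEΩ : E ⊆ Ω := by
    rintro z ⟨h1, -⟩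
    refine lt_of_le_of_lt (ENNReal.ofReal_le_ofReal ?_) h1
    nlinarith
  have hop : IsOpen Ω := (Ns_lsc hK hn hC hα hε ρ hg hg1).isOpen_preimage _
  have hfin : ∀ x r, μ (closedBall x r) ≠ ∞ := by
    intro x r
    refine ne_top_of_le_ne_top ENNReal.ofReal_ne_top
      ((measure_mono (closedBall_subset_closedBall (le_max_left r 1))).trans (hμ x (max r 1) (by positivity)))
  -- boundedness
  obtain ⟨M, hM⟩ : ∃ M, Ω ⊆ closedBall 0 M := by
    set m := (ρ univ).toReal with hm
    have hm0 : 0 ≤ m := ENNReal.toReal_nonneg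
    refine ⟨max (2 * R) ((C * 2 ^ n * m / lam) ^ (1 / n)), fun x hx => ?_⟩
    rw [mem_closedBall, dist_zero_right]
    by_contra hcon
    rw [not_le, max_lt_iff] at hcon
    have hx0 : 0 < ‖x‖ := by linarith
    have hx : ENNReal.ofReal lam < Ns K ε ρ g x := hx
    have h1 := hx.trans_le (Ns_decay hK hn hC hR ρ hρ hg1 hcon.1.le)
    rw [← ENNReal.ofReal_toReal (measure_ne_top ρ univ), ← hm, ← ENNReal.ofReal_mul (by positivity)] at h1
    have h2 := (ENNReal.ofReal_lt_ofReal_iff_of_nonneg hl.le).1 h1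
    have h3 : C * 2 ^ n * m / lam < ‖x‖ ^ n := by
      have := Real.rpow_lt_rpow (by positivity) hcon.2 hn
      rwa [← Real.rpow_mul (by positivity), one_div_mul_cancel hn.ne', Real.rpow_one] at this
    rw [div_lt_iff₀ hl] at h3
    rw [div_mul_eq_mul_div, lt_div_iff₀ (by positivity)] at h2
    linarith
  have hmΩ : μ Ω ≠ ∞ := ne_top_of_le_ne_top (hfin 0 M) (measure_mono hM)
  have hΩc : (Ωᶜ).Nonempty := by
    have : Nonempty (Fin d) := ⟨⟨0, hd⟩⟩
    obtain ⟨y, hy⟩ := NormedSpace.exists_lt_norm ℝ (Pt d) M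
    refine ⟨y, fun h => ?_⟩
    have := hM h
    rw [mem_closedBall, dist_zero_right] at this
    linarith
  obtain ⟨y0, hy0⟩ := hΩc
  have hpos : ∀ x ∈ Ω, 0 < infDist x Ωᶜ := fun x hx =>
    (hop.isClosed_compl.notMem_iff_infDist_pos ⟨y0, hy0⟩).1 (fun h => h hx)
  set D : Pt d → ℝ := fun x => infDist x Ωᶜ / a with hD
  have hDpos : ∀ x ∈ Ω, 0 < D x := fun x hx => div_pos (hpos x hx) ha0
  have hDR : ∀ x ∈ Ω, D x ≤ (M + ‖y0‖) := by
    intro x hx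
    have h1 : infDist x Ωᶜ ≤ dist x y0 := infDist_le_dist_of_mem hy0
    have h2 := hM hx
    rw [mem_closedBall, dist_zero_right] at h2
    have h3 : dist x y0 ≤ ‖x‖ + ‖y0‖ := dist_le_norm_add_norm x y0
    refine (div_le_self (hpos x hx).le (by linarith)).trans (by linarith)
  have hDsub : ∀ x ∈ Ω, ∀ t, t ≤ cc * D x → closedBall x t ⊆ Ω := by
    intro x hx t ht y hy
    by_contra hcon
    have h1 : infDist x Ωᶜ ≤ dist x y := infDist_le_dist_of_mem hcon
    rw [mem_closedBall, dist_comm] at hy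
    have h2 : infDist x Ωᶜ = a * D x := by rw [hD]; field_simp
    have := hDpos x hx
    nlinarith
  have hnull := ae_doubling μ (a := a) (by linarith) Ω D (R := M + ‖y0‖)
    (ne_top_of_le_ne_top measure_closedBall_lt_top.ne (measure_mono hM)) hDpos hDR
    (fun x hx => hDsub x hx _ (by have := hDpos x hx; nlinarith)) hfin
  rw [← hbd] at hnull
  set Z := {x ∈ Ω | ∀ j : ℕ, ENNReal.ofReal b * μ (closedBall x (D x / a ^ j)) <
      μ (closedBall x (a * (D x / a ^ j)))} with hZ
  have hsel : ∀ x ∈ Ω \ Z, ∃ (s : ℝ) (k : ℕ), 0 < s ∧ a ^ k * s = D x ∧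
      μ (closedBall x (a * s)) ≤ ENNReal.ofReal b * μ (closedBall x s) ∧
      ∀ j, 1 ≤ j → j ≤ k → ENNReal.ofReal b * μ (closedBall x (a ^ j * s)) ≤
        μ (closedBall x (a ^ (j+1) * s)) := by
    rintro x ⟨hx, hxZ⟩
    have hex : ∃ j : ℕ, μ (closedBall x (a * (D x / a ^ j))) ≤
        ENNReal.ofReal b * μ (closedBall x (D x / a ^ j)) := by
      by_contra hcon
      push Not at hcon
      exact hxZ ⟨hx, hcon⟩
    classical
    have hDx := hDpos x hx
    refine ⟨D x / a ^ Nat.find hex, Nat.find hex, by positivity, by field_simp, Nat.find_spec hex, ?_⟩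
    intro j h1 h2
    have := Nat.find_min hex (m := Nat.find hex - j) (by omega)
    rw [not_le] at this
    have e1 : a ^ j * (D x / a ^ Nat.find hex) = D x / a ^ (Nat.find hex - j) := by
      have : a ^ Nat.find hex = a ^ j * a ^ (Nat.find hex - j) := by
        rw [← pow_add]; congr 1; omega
      rw [this]; field_simp
    rw [pow_succ, mul_comm (a ^ j) a, mul_assoc, e1]
    exact this.le
  choose! s k hs hsk hdoub hnd using hsel
  have hsD : ∀ x ∈ Ω \ Z, s x ≤ D x := by
    intro x hx
    rw [← hsk x hx]
    exact le_mul_of_one_le_left (hs x hx).le (one_le_pow₀ (by linarith))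
  obtain ⟨u, huS, huc, hud, hucov⟩ := vitali_family (Ω \ Z) (fun x => cc * s x) (cc * (M + ‖y0‖))
    (fun x hx => by have := hs x hx; positivity)
    (fun x hx => mul_le_mul_of_nonneg_left ((hsD x hx).trans (hDR x hx.1)) (by linarith))
  have hBP' : ∀ x ∈ u, _ := fun x hx => hBP x (s x) (hs x (huS hx)) (hdoub x (huS hx))
  choose! G hGm hGs hGθ hGT using hBP'
  have := huc.to_subtype
  have hballs : ∑' x : u, μ (closedBall x.1 (s x)) ≤ μ Ω := by
    rw [← measure_biUnion (f := fun x => closedBall x (s x)) huc _ (fun x _ => isClosed_closedBall.measurableSet)]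
    · refine measure_mono (iUnion₂_subset fun x hx => hDsub x (huS hx).1 _ ?_)
      have h1 := hsD x (huS hx)
      have h2 := hs x (huS hx)
      nlinarith
    · refine hud.mono_on fun x hx => closedBall_subset_closedBall ?_
      have h2 := hs x (huS hx)
      nlinarith
  set U := ⋃ x ∈ u, G x with hU
  have hUm : MeasurableSet U := MeasurableSet.biUnion huc hGm
  have hUΩ : U ⊆ Ω := iUnion₂_subset fun x hx => (hGs x hx).trans (hDsub x (huS hx).1 _ (by
      have h1 := hsD x (huS hx)
      gcongr))
  have hμU : ENNReal.ofReal (θ / b) * μ Ω ≤ μ U := by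
    have h1 : μ Ω ≤ ENNReal.ofReal b * ∑' x : u, μ (closedBall x.1 (s x)) := by
      calc μ Ω ≤ μ (Z ∪ (Ω \ Z)) := measure_mono (by
              intro x hx
              by_cases h : x ∈ Z
              · exact Or.inl h
              · exact Or.inr ⟨hx, h⟩)
        _ ≤ μ Z + μ (Ω \ Z) := measure_union_le _ _
        _ = μ (Ω \ Z) := by rw [hnull, zero_add]
        _ ≤ μ (⋃ x ∈ u, closedBall x (5 * (cc * s x))) := measure_mono hucov
        _ ≤ ∑' x : u, μ (closedBall x.1 (5 * (cc * s x))) := measure_biUnion_le _ huc _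
        _ ≤ ∑' x : u, ENNReal.ofReal b * μ (closedBall x.1 (s x)) := by
            refine ENNReal.tsum_le_tsum fun x => le_trans (measure_mono (closedBall_subset_closedBall ?_))
              (hdoub x.1 (huS x.2))
            have := hs x.1 (huS x.2)
            nlinarith
        _ = _ := ENNReal.tsum_mul_left
    have h2 : ENNReal.ofReal θ * ∑' x : u, μ (closedBall x.1 (s x)) ≤ μ U := by
      rw [hU, measure_biUnion huc _ hGm, ← ENNReal.tsum_mul_left]
      · exact ENNReal.tsum_le_tsum fun x => hGθ x.1 x.2
      · exact hud.mono_on fun x hx => hGs x hx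
    calc _ ≤ ENNReal.ofReal (θ / b) * (ENNReal.ofReal b * ∑' x : u, μ (closedBall x.1 (s x))) := by
          gcongr
      _ = ENNReal.ofReal θ * ∑' x : u, μ (closedBall x.1 (s x)) := by
          rw [← mul_assoc, ← ENNReal.ofReal_mul (by positivity), div_mul_cancel₀ _ hb0.ne']
      _ ≤ _ := h2
  have hEU : μ (E ∩ U) ≤ ENNReal.ofReal (θ / (2 * b)) * μ Ω := by
    calc μ (E ∩ U) ≤ μ (⋃ x ∈ u, E ∩ G x) := by rw [hU, inter_iUnion₂]
      _ ≤ ∑' x : u, μ (E ∩ G x.1) := measure_biUnion_le _ huc _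
      _ ≤ ∑' x : u, ENNReal.ofReal (θ / (2 * b)) * μ (closedBall x.1 (s x)) := by
          refine ENNReal.tsum_le_tsum fun x => ?_
          have hx := huS x.2
          have hDx := hDpos x.1 hx.1
          obtain ⟨z0, hz0, hz0d⟩ := (infDist_lt_iff (x := x.1) (r := 2 * (a * D x)) ⟨y0, hy0⟩).1 (by
            have h2 : infDist x.1 Ωᶜ = a * D x := by rw [hD]; field_simp
            rw [h2]; nlinarith [mul_pos ha0 hDx])
          refine (piece_bound hK hn hC hα hα1 ha hb hc hA μ hμ hε hg hg1 ρ x.1 z0 (hs _ hx) (k x.1) hcc hcca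
            (hdoub _ hx) (hnd _ hx) (by rw [hsk _ hx]; exact hz0d.le) (hGm _ x.2) (hGs _ x.2)
            (fun ρ hρ lam hlam => hGT x.1 x.2 ρ hρ g hg1 ε hε lam hlam) hl hη hδ hδ1 (not_lt.1 hz0)).trans ?_
          exact mul_le_mul_left (ENNReal.ofReal_le_ofReal hδ2) _
      _ = ENNReal.ofReal (θ / (2 * b)) * ∑' x : u, μ (closedBall x.1 (s x)) := ENNReal.tsum_mul_left
      _ ≤ _ := by gcongr
  have hsplit : μ E ≤ μ (Ω \ U) + μ (E ∩ U) := by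
    refine (measure_mono ?_).trans (measure_union_le _ _)
    intro z hz
    by_cases h : z ∈ U
    · exact Or.inr ⟨hz, h⟩
    · exact Or.inl ⟨hEΩ hz, h⟩
  have hUfin : μ U ≠ ∞ := ne_top_of_le_ne_top hmΩ (measure_mono hUΩ)
  have hsum : μ (Ω \ U) + μ U = μ Ω := by
    rw [add_comm]
    have := measure_inter_add_sdiff Ω (μ := μ) hUm
    rwa [inter_eq_self_of_subset_right hUΩ] at this
  have hdfin : μ (Ω \ U) ≠ ∞ := ne_top_of_le_ne_top hmΩ (measure_mono sdiff_subset)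
  have hmain := hsplit.trans (add_le_add le_rfl hEU)
  rw [← ENNReal.ofReal_toReal hmΩ, ← ENNReal.ofReal_toReal hdfin] at hmain
  rw [← ENNReal.ofReal_toReal hmΩ, ← ENNReal.ofReal_toReal hUfin] at hμU
  have hs' := congrArg ENNReal.toReal hsum
  rw [ENNReal.toReal_add hdfin hUfin] at hs'
  rw [← ENNReal.ofReal_mul (by positivity), ENNReal.ofReal_le_ofReal_iff (by positivity)] at hμU
  rw [← ENNReal.ofReal_mul (by positivity), ← ENNReal.ofReal_add (by positivity) (by positivity)] at hmain
  rw [← ENNReal.ofReal_toReal hmΩ, ← ENNReal.ofReal_mul' (by positivity)]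
  refine hmain.trans (ENNReal.ofReal_le_ofReal ?_)
  have e : θ / b = 2 * (θ / (2 * b)) := by field_simp
  rw [e] at hμU
  nlinarith

end GLam

namespace GLam

variable {d : ℕ} {n C α : ℝ} {K : Pt d → Pt d → ℂ}

def dn (μ : Measure (Pt d)) (f : Pt d → ℂ) : Measure (Pt d) := μ.withDensity (fun x => ‖f x‖ₑ)

def sg (f : Pt d → ℂ) (x : Pt d) : ℂ := f x / ‖f x‖

theorem sg_meas {f : Pt d → ℂ} (hf : Measurable f) : Measurable (sg f) := by
  unfold sg; fun_prop

theorem sg_le (f : Pt d → ℂ) (x : Pt d) : ‖sg f x‖ ≤ 1 := by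
  unfold sg
  rw [norm_div, Complex.norm_real, norm_norm]
  exact div_self_le_one _

theorem norm_mul_sg (f : Pt d → ℂ) (x : Pt d) : (‖f x‖ : ℂ) * sg f x = f x := by
  unfold sg
  by_cases h : f x = 0
  · simp [h]
  · have : (‖f x‖ : ℂ) ≠ 0 := by simpa using h
    field_simp

theorem truncT_dn (μ : Measure (Pt d)) {f : Pt d → ℂ} (hf : Measurable f) (ε : ℝ) (x : Pt d) :
    truncT μ K ε f x = truncT (dn μ f) K ε (sg f) x := by
  unfold truncT dn
  rw [restrict_withDensity (measurableSet_lt measurable_const (by fun_prop)),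
    integral_withDensity_eq_integral_toReal_smul (by fun_prop) (by simp)]
  refine integral_congr_ae (Filter.Eventually.of_forall fun y => ?_)
  show K x y * f y = (‖f y‖ₑ).toReal • (K x y * sg f y)
  rw [toReal_enorm, Complex.real_smul, mul_left_comm, norm_mul_sg]

theorem hard_soft (hK : IsCZKernel K n C α) (hn : 0 < n) (hC : 0 < C) (hα : 0 < α)
    {ε : ℝ} (hε : 0 < ε) (ρ : Measure (Pt d)) [IsFiniteMeasure ρ] {g : Pt d → ℂ}
    (hg : Measurable g) (hg1 : ∀ x, ‖g x‖ ≤ 1) (x : Pt d) :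
    ‖truncT ρ K ε g x‖ₑ ≤ Ns K ε ρ g x + ENNReal.ofReal (C / ε ^ n * (ρ (closedBall x (2 * ε))).toReal) := by
  have hm : MeasurableSet {y : Pt d | ε < dist x y} := measurableSet_lt measurable_const (by fun_prop)
  have hi1 := integrableOn_hard hK hn hC hα hε ρ hg hg1 x
  have hi2 := integrable_kr hK hn hC hα hε ρ hg hg1 x
  have e : truncT ρ K ε g x = Tr K ε ρ g x + ∫ y in {y | ε < dist x y}, (K x y - kr K ε x y) * g y ∂ρ := by
    have h1 : Tr K ε ρ g x = ∫ y in {y | ε < dist x y}, kr K ε x y * g y ∂ρ := by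
      unfold Tr
      rw [setIntegral_eq_integral_of_forall_compl_eq_zero]
      intro y hy
      have hy : ¬ (ε < dist x y) := hy
      rw [kr_zero K hε (not_lt.1 hy), zero_mul]
    rw [h1, ← integral_add hi2.integrableOn]
    · unfold truncT
      congr 1; ext y; ring
    · have := hi1.sub hi2.integrableOn
      refine this.congr (Filter.Eventually.of_forall fun y => ?_)
      simp [sub_mul]
  rw [e]
  refine (enorm_add_le _ _).trans (add_le_add (le_iSup₂_of_le ε le_rfl le_rfl) ?_)
  refine (enorm_integral_le_kernel hg1).trans ?_
  refine near_bound' hK hn hC ρ x (t := 2 * ε) hε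
    (le_of_eq (ENNReal.ofReal_toReal (measure_ne_top _ _)).symm) _ (fun y => ?_) _ hm ?_
  · have : K x y - kr K ε x y = ((1 - phi (dist x y / ε) : ℝ) : ℂ) * K x y := by
      unfold kr; push_cast; ring
    rw [this, norm_mul, Complex.norm_real, Real.norm_eq_abs, abs_of_nonneg (by linarith [phi_le_one (dist x y / ε)])]
    exact mul_le_of_le_one_left (norm_nonneg _) (by linarith [phi_nonneg (dist x y / ε)])
  · intro y hy h0
    refine ⟨hy, ?_⟩
    by_contra h
    rw [not_le] at h
    exact h0 (by rw [kr_eq K hε h.le, sub_self])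

theorem notPP_weak (μ : Measure (Pt d)) {f : Pt d → ℂ} (hf : Measurable f)
    (hfin : ∀ x r, μ (closedBall x r) ≠ ∞) {τ : ℝ} (hτ : 0 < τ) :
    μ {z | ¬ PP μ (dn μ f) τ z} ≤ (ENNReal.ofReal (τ / 2))⁻¹ * dn μ f {y | τ / 2 < ‖f y‖} := by
  have hm : MeasurableSet {y | τ / 2 < ‖f y‖} := measurableSet_lt measurable_const (by fun_prop)
  have key := vitali_univ μ ((dn μ f).restrict {y | τ / 2 < ‖f y‖}) ((ENNReal.ofReal (τ / 2))⁻¹)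
    {z | ¬ PP μ (dn μ f) τ z} ?_
  · rwa [Measure.restrict_apply_univ] at key
  intro z hz
  have hz : ¬ PP μ (dn μ f) τ z := hz
  unfold PP at hz
  push Not at hz
  obtain ⟨t, ht, hlt⟩ := hz
  refine ⟨t, ht, ?_⟩
  rw [← ENNReal.div_eq_inv_mul, ENNReal.le_div_iff_mul_le (by simp [hτ]) (by simp), mul_comm,
    Measure.restrict_apply isClosed_closedBall.measurableSet]
  have h2 : dn μ f (closedBall z t \ {y | τ / 2 < ‖f y‖}) ≤ ENNReal.ofReal (τ / 2) * μ (closedBall z (5 * t)) := by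
    unfold dn
    rw [withDensity_apply _ (isClosed_closedBall.measurableSet.diff hm)]
    calc _ ≤ ∫⁻ y in closedBall z t \ {y | τ / 2 < ‖f y‖}, ENNReal.ofReal (τ / 2) ∂μ := by
          refine setLIntegral_mono' (isClosed_closedBall.measurableSet.diff hm) fun y hy => ?_
          have hy : ¬ (τ / 2 < ‖f y‖) := hy.2
          rw [← ofReal_norm]
          exact ENNReal.ofReal_le_ofReal (not_lt.1 hy)
      _ = ENNReal.ofReal (τ / 2) * μ (closedBall z t \ {y | τ / 2 < ‖f y‖}) := by simp
      _ ≤ _ := by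
          gcongr
          exact sdiff_subset.trans (closedBall_subset_closedBall (by linarith))
  have h3 := measure_inter_add_sdiff (μ := dn μ f) (closedBall z t) hm
  rw [← h3] at hlt
  have h4 : ENNReal.ofReal τ * μ (closedBall z (5 * t)) =
      ENNReal.ofReal (τ / 2) * μ (closedBall z (5 * t)) + ENNReal.ofReal (τ / 2) * μ (closedBall z (5 * t)) := by
    rw [← add_mul, ← ENNReal.ofReal_add (by positivity) (by positivity)]; congr 2; ring
  rw [h4] at hlt
  have h5 := hlt.le.trans (add_le_add le_rfl h2)
  exact ENNReal.le_of_add_le_add_right (ENNReal.mul_ne_top ENNReal.ofReal_ne_top (hfin _ _)) h5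

theorem pp_int (μ : Measure (Pt d)) {f : Pt d → ℂ} (hf : Measurable f)
    (hfin : ∀ x r, μ (closedBall x r) ≠ ∞) {δ p : ℝ} (hδ : 0 < δ) (hp : 1 < p) :
    ∫⁻ t in Ioi (0:ℝ), μ {z | ¬ PP μ (dn μ f) (δ * t) z} * ENNReal.ofReal (t ^ (p - 1)) ≤
      ENNReal.ofReal ((2 / δ) ^ p / (p - 1)) * ∫⁻ x, ‖f x‖ₑ ^ p ∂μ := by
  have hp1 : 0 < p - 1 := by linarith
  have hlc := lintegral_rpow_eq_lintegral_meas_lt_mul (dn μ f) (f := fun y => 2 / δ * ‖f y‖)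
    (Filter.Eventually.of_forall fun y => by positivity) (by fun_prop) hp1
  have hle : ∫⁻ t in Ioi (0:ℝ), μ {z | ¬ PP μ (dn μ f) (δ * t) z} * ENNReal.ofReal (t ^ (p - 1)) ≤
      ENNReal.ofReal (2 / δ) * ∫⁻ t in Ioi (0:ℝ), dn μ f {a | t < 2 / δ * ‖f a‖} * ENNReal.ofReal (t ^ (p - 1 - 1)) := by
    rw [← lintegral_const_mul' _ _ ENNReal.ofReal_ne_top]
    refine setLIntegral_mono' measurableSet_Ioi fun t ht => ?_
    have ht : 0 < t := ht
    refine (mul_le_mul_left (notPP_weak μ hf hfin (by positivity)) _).trans (le_of_eq ?_)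
    have e1 : {y | δ * t / 2 < ‖f y‖} = {a | t < 2 / δ * ‖f a‖} := by
      ext y
      show δ * t / 2 < ‖f y‖ ↔ t < 2 / δ * ‖f y‖
      rw [div_mul_eq_mul_div, lt_div_iff₀ hδ, div_lt_iff₀ (by norm_num)]
      constructor <;> intro h <;> linarith
    rw [e1, ← ENNReal.ofReal_inv_of_pos (by positivity), mul_right_comm, ← ENNReal.ofReal_mul (by positivity),
      mul_comm (dn μ f _), ← mul_assoc, ← ENNReal.ofReal_mul (by positivity)]
    congr 2
    rw [Real.rpow_sub_one ht.ne' (p - 1)]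
    field_simp
  refine hle.trans (le_of_eq ?_)
  have hJ : ∫⁻ t in Ioi (0:ℝ), dn μ f {a | t < 2 / δ * ‖f a‖} * ENNReal.ofReal (t ^ (p - 1 - 1)) =
      (ENNReal.ofReal (p - 1))⁻¹ * ∫⁻ y, ENNReal.ofReal ((2 / δ * ‖f y‖) ^ (p - 1)) ∂(dn μ f) := by
    rw [hlc, ← mul_assoc, ENNReal.inv_mul_cancel (by simpa using hp1) (by simp), one_mul]
  have hI : ∫⁻ y, ENNReal.ofReal ((2 / δ * ‖f y‖) ^ (p - 1)) ∂(dn μ f) =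
      ENNReal.ofReal ((2 / δ) ^ (p - 1)) * ∫⁻ x, ‖f x‖ₑ ^ p ∂μ := by
    unfold dn
    rw [lintegral_withDensity_eq_lintegral_mul _ (by fun_prop) (by fun_prop),
      ← lintegral_const_mul' _ _ ENNReal.ofReal_ne_top]
    refine lintegral_congr fun y => ?_
    simp only [Pi.mul_apply]
    rw [← ofReal_norm, ENNReal.ofReal_rpow_of_nonneg (norm_nonneg _) (by linarith),
      ← ENNReal.ofReal_mul (norm_nonneg _), ← ENNReal.ofReal_mul (by positivity)]
    congr 1
    rw [Real.mul_rpow (by positivity) (norm_nonneg _), mul_left_comm]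
    congr 1
    by_cases h : ‖f y‖ = 0
    · rw [h, Real.zero_rpow (by linarith), Real.zero_rpow (by linarith), zero_mul]
    · rw [Real.rpow_sub_one h]; field_simp
  rw [hJ, hI, ← mul_assoc, ← mul_assoc, ← ENNReal.ofReal_inv_of_pos hp1, ← ENNReal.ofReal_mul (by positivity),
    ← ENNReal.ofReal_mul (by positivity)]
  congr 2
  rw [Real.rpow_sub_one (by positivity)]
  field_simp

/-- bound for the averages at scale `ε` -/
theorem mass_int (hn : 0 < n) (hC : 0 < C) {c : ℝ} (hc : 0 < c) (μ : Measure (Pt d)) {f : Pt d → ℂ}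
    (hf : Measurable f) [IsFiniteMeasure (dn μ f)]
    (hμ : ∀ x r, 0 < r → μ (closedBall x r) ≤ ENNReal.ofReal (c * r ^ n))
    (hfin : ∀ x r, μ (closedBall x r) ≠ ∞) {p : ℝ} (hp : 1 < p) {ε : ℝ} (hε : 0 < ε) :
    Measurable (fun x => C / ε ^ n * (dn μ f (closedBall x (2 * ε))).toReal) ∧
    ∫⁻ x, ENNReal.ofReal ((C / ε ^ n * (dn μ f (closedBall x (2 * ε))).toReal) ^ p) ∂μ ≤
      ENNReal.ofReal (p * ((2 * (C * c * 10 ^ n)) ^ p / (p - 1))) * ∫⁻ x, ‖f x‖ₑ ^ p ∂μ := by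
  have hmeas : Measurable (fun x => C / ε ^ n * (dn μ f (closedBall x (2 * ε))).toReal) := by
    have hs : MeasurableSet {q : Pt d × Pt d | dist q.2 q.1 ≤ 2 * ε} :=
      measurableSet_le (by fun_prop) measurable_const
    have := measurable_measure_prodMk_left (ν := dn μ f) hs
    exact (this.ennreal_toReal).const_mul _
  refine ⟨hmeas, ?_⟩
  rw [lintegral_rpow_eq_lintegral_meas_lt_mul μ (Filter.Eventually.of_forall fun y => by positivity)
    hmeas.aemeasurable (by linarith)]
  set δ := 1 / (C * c * 10 ^ n) with hδ
  have hδ0 : 0 < δ := by positivity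
  have h := pp_int μ hf hfin hδ0 hp
  have e : 2 / δ = 2 * (C * c * 10 ^ n) := by rw [hδ]; field_simp
  rw [e] at h
  rw [ENNReal.ofReal_mul (by linarith), mul_assoc]
  refine mul_le_mul_right (le_trans ?_ h) _
  refine setLIntegral_mono' measurableSet_Ioi fun t ht => mul_le_mul_left (measure_mono ?_) _
  have ht : 0 < t := ht
  intro x hx hP
  have hx : t < C / ε ^ n * (dn μ f (closedBall x (2 * ε))).toReal := hx
  have h1 := (hP (2 * ε) (by positivity)).trans (mul_le_mul_right (hμ x _ (by positivity)) _)
  rw [← ENNReal.ofReal_mul (by positivity)] at h1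
  have h2 := ENNReal.toReal_le_of_le_ofReal (by positivity) h1
  rw [show 5 * (2 * ε) = 10 * ε by ring, Real.mul_rpow (by norm_num) hε.le] at h2
  have h3 : C / ε ^ n * (dn μ f (closedBall x (2 * ε))).toReal ≤ C / ε ^ n * (δ * t * (c * (10 ^ n * ε ^ n))) := by
    gcongr
  have h4 : C / ε ^ n * (δ * t * (c * (10 ^ n * ε ^ n))) = t := by
    rw [hδ]
    have : ε ^ n ≠ 0 := by positivity
    field_simp
  linarith

end GLam

namespace GLam

variable {d : ℕ} {n C α : ℝ} {K : Pt d → Pt d → ℂ}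

theorem absorb {X : Type*} [MeasurableSpace X] (μ : Measure X) {N : X → ℝ} (hN : Measurable N)
    (hN0 : ∀ x, 0 ≤ N x) {p η γ : ℝ} (hp : 1 < p) (hη : 0 < η) (hγ : 0 < γ) (hγ1 : γ < 1)
    (hg : (1 + η) ^ p * (1 - γ) = 1 - γ / 2)
    (hI : ∫⁻ x, ENNReal.ofReal (N x ^ p) ∂μ ≠ ∞) (B : ℝ → Set X)
    (h : ∀ t, 0 < t → μ {x | (1 + η) * t < N x} ≤ ENNReal.ofReal (1 - γ) * μ {x | t < N x} + μ (B t)) :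
    ∫⁻ x, ENNReal.ofReal (N x ^ p) ∂μ ≤ ENNReal.ofReal (2 / γ * ((1 + η) ^ p * p)) *
      ∫⁻ t in Ioi (0:ℝ), μ (B t) * ENNReal.ofReal (t ^ (p - 1)) := by
  have hp0 : 0 < p := by linarith
  have h1 := lintegral_rpow_eq_lintegral_meas_lt_mul μ (f := N)
    (Filter.Eventually.of_forall hN0) hN.aemeasurable hp0
  have h2 := lintegral_rpow_eq_lintegral_meas_lt_mul μ (f := fun x => N x / (1 + η))
    (Filter.Eventually.of_forall fun x => div_nonneg (hN0 x) (by positivity)) (by fun_prop) hp0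
  set I := ∫⁻ x, ENNReal.ofReal (N x ^ p) ∂μ with hIdef
  set J := ∫⁻ t in Ioi (0:ℝ), μ (B t) * ENNReal.ofReal (t ^ (p - 1)) with hJ
  have hanti : Measurable fun t : ℝ => μ {x | t < N x} := by
    refine Antitone.measurable fun s t hst => measure_mono fun x hx => lt_of_le_of_lt hst hx
  have hmm : Measurable fun t : ℝ => ENNReal.ofReal (1 - γ) * (μ {x | t < N x} * ENNReal.ofReal (t ^ (p - 1))) :=
    (hanti.mul (by fun_prop)).const_mul _
  have h3 : ∫⁻ t in Ioi (0:ℝ), μ {x | t < N x / (1 + η)} * ENNReal.ofReal (t ^ (p - 1)) ≤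
      ENNReal.ofReal (1 - γ) * (∫⁻ t in Ioi (0:ℝ), μ {x | t < N x} * ENNReal.ofReal (t ^ (p - 1))) + J := by
    rw [← lintegral_const_mul' _ _ ENNReal.ofReal_ne_top, hJ, ← lintegral_add_left hmm]
    refine setLIntegral_mono' measurableSet_Ioi fun t ht => ?_
    have e : {x | t < N x / (1 + η)} = {x | (1 + η) * t < N x} := by
      ext x
      show t < N x / (1 + η) ↔ (1 + η) * t < N x
      rw [lt_div_iff₀ (by positivity), mul_comm]
    rw [e, ← mul_assoc, ← add_mul]
    exact mul_le_mul_left (h t ht) _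
  have h4 : I = ENNReal.ofReal ((1 + η) ^ p) * ∫⁻ x, ENNReal.ofReal ((N x / (1 + η)) ^ p) ∂μ := by
    rw [← lintegral_const_mul' _ _ ENNReal.ofReal_ne_top]
    refine lintegral_congr fun x => ?_
    rw [← ENNReal.ofReal_mul (by positivity), ← Real.mul_rpow (by positivity) (div_nonneg (hN0 x) (by positivity))]
    congr 2
    field_simp
  have h5 : I ≤ ENNReal.ofReal (1 - γ / 2) * I + ENNReal.ofReal ((1 + η) ^ p * p) * J := by
    calc I = ENNReal.ofReal ((1 + η) ^ p) * (ENNReal.ofReal p * ∫⁻ t in Ioi (0:ℝ), μ {x | t < N x / (1 + η)} * ENNReal.ofReal (t ^ (p - 1))) := by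
          rw [h4, h2]
      _ ≤ ENNReal.ofReal ((1 + η) ^ p) * (ENNReal.ofReal p * (ENNReal.ofReal (1 - γ) * (∫⁻ t in Ioi (0:ℝ), μ {x | t < N x} * ENNReal.ofReal (t ^ (p - 1))) + J)) := by
          gcongr
      _ = _ := by
          rw [h1, ← hg, ENNReal.ofReal_mul (by positivity), ENNReal.ofReal_mul (by positivity)]
          ring
  have h6 : I = ENNReal.ofReal (1 - γ / 2) * I + ENNReal.ofReal (γ / 2) * I := by
    rw [← add_mul, ← ENNReal.ofReal_add (by linarith) (by linarith)]; simp
  have h7 : ENNReal.ofReal (γ / 2) * I ≤ ENNReal.ofReal ((1 + η) ^ p * p) * J := by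
    have : ENNReal.ofReal (1 - γ / 2) * I + ENNReal.ofReal (γ / 2) * I ≤ ENNReal.ofReal (1 - γ / 2) * I + ENNReal.ofReal ((1 + η) ^ p * p) * J := h6 ▸ h5
    exact ENNReal.le_of_add_le_add_left (ENNReal.mul_ne_top ENNReal.ofReal_ne_top hI) this
  calc I = ENNReal.ofReal (2 / γ) * (ENNReal.ofReal (γ / 2) * I) := by
        rw [← mul_assoc, ← ENNReal.ofReal_mul (by positivity)]
        rw [show 2 / γ * (γ / 2) = 1 by field_simp]; simp
    _ ≤ ENNReal.ofReal (2 / γ) * (ENNReal.ofReal ((1 + η) ^ p * p) * J) := by gcongr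
    _ = _ := by rw [← mul_assoc, ← ENNReal.ofReal_mul (by positivity)]

theorem Nr_fin (hK : IsCZKernel K n C α) (hn : 0 < n) (hC : 0 < C) {c p ε R : ℝ} (hc : 0 < c) (hp : 1 < p)
    (μ : Measure (Pt d)) (hμ : ∀ x r, 0 < r → μ (closedBall x r) ≤ ENNReal.ofReal (c * r ^ n))
    (hε : 0 < ε) {g : Pt d → ℂ} (hg1 : ∀ x, ‖g x‖ ≤ 1)
    (ρ : Measure (Pt d)) [IsFiniteMeasure ρ] (hR : 0 < R) (hρ : ρ (closedBall 0 R)ᶜ = 0) :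
    ∫⁻ x, ENNReal.ofReal ((Ns K ε ρ g x).toReal ^ p) ∂μ ≠ ∞ := by
  set m := (ρ univ).toReal with hm
  have hm0 : 0 ≤ m := ENNReal.toReal_nonneg
  have hmE : ρ univ = ENNReal.ofReal m := (ENNReal.ofReal_toReal (measure_ne_top _ _)).symm
  have hms : MeasurableSet (closedBall (0 : Pt d) (2 * R)) := isClosed_closedBall.measurableSet
  rw [← lintegral_add_compl _ hms]
  refine ENNReal.add_ne_top.2 ⟨?_, ?_⟩
  · refine ne_top_of_le_ne_top (b := ∫⁻ x in closedBall (0 : Pt d) (2 * R), ENNReal.ofReal ((C / ε ^ n * m) ^ p) ∂μ) ?_ ?_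
    · rw [setLIntegral_const]
      exact ENNReal.mul_ne_top ENNReal.ofReal_ne_top (ne_top_of_le_ne_top ENNReal.ofReal_ne_top (hμ _ _ (by positivity)))
    · refine lintegral_mono fun x => ENNReal.ofReal_le_ofReal ?_
      refine Real.rpow_le_rpow ENNReal.toReal_nonneg ?_ (by linarith)
      have := Ns_bdd hK hn hC ρ hε hg1 x
      rw [hmE, ← ENNReal.ofReal_mul (by positivity)] at this
      exact ENNReal.toReal_le_of_le_ofReal (by positivity) this
  · have hα' : 0 < n * (p - 1) := mul_pos hn (by linarith)
    have far := far_integral hn hα' μ (0 : Pt d) (D := 2 * R) (τ := c) (by positivity) hc.le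
      (fun s hs => hμ _ _ (by linarith))
    have hset : (closedBall (0 : Pt d) (2 * R))ᶜ = {y | 2 * R < dist (0 : Pt d) y} := by
      ext y
      show ¬ (dist y 0 ≤ 2 * R) ↔ 2 * R < dist 0 y
      rw [not_le, dist_comm]
    rw [hset]
    have hms2 : MeasurableSet {y : Pt d | 2 * R < dist (0 : Pt d) y} := hset ▸ hms.compl
    refine ne_top_of_le_ne_top (b := ENNReal.ofReal ((C * 2 ^ n * m) ^ p / (2 * R) ^ (n * (p - 1))) *
      ∫⁻ y in {y | 2 * R < dist (0 : Pt d) y}, ENNReal.ofReal ((2 * R / dist 0 y) ^ (n * (p - 1)) / dist 0 y ^ n) ∂μ) ?_ ?_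
    · exact ENNReal.mul_ne_top ENNReal.ofReal_ne_top (ne_top_of_le_ne_top ENNReal.ofReal_ne_top far)
    · rw [← lintegral_const_mul' _ _ ENNReal.ofReal_ne_top]
      refine setLIntegral_mono' hms2 fun y hy => ?_
      have hy : 2 * R < dist (0 : Pt d) y := hy
      have hy' : 2 * R < ‖y‖ := by rwa [dist_zero_left] at hy
      have hy0 : 0 < ‖y‖ := by linarith
      rw [dist_zero_left, ← ENNReal.ofReal_mul (by positivity)]
      refine ENNReal.ofReal_le_ofReal ?_
      have h1 := Ns_decay (ε := ε) hK hn hC hR ρ hρ hg1 hy'.le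
      rw [hmE, ← ENNReal.ofReal_mul (by positivity)] at h1
      have h2 := ENNReal.toReal_le_of_le_ofReal (by positivity) h1
      refine (Real.rpow_le_rpow ENNReal.toReal_nonneg h2 (by linarith)).trans (le_of_eq ?_)
      rw [show C * 2 ^ n / ‖y‖ ^ n * m = C * 2 ^ n * m / ‖y‖ ^ n by ring,
        Real.div_rpow (by positivity) (by positivity), Real.div_rpow (by positivity) (by positivity),
        ← Real.rpow_mul hy0.le]
      have e : ‖y‖ ^ (n * p) = ‖y‖ ^ (n * (p - 1)) * ‖y‖ ^ n := by
        rw [← Real.rpow_add hy0]; congr 1; ring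
      rw [e]
      field_simp

end GLam

namespace GLam

variable {d : ℕ} {n C α : ℝ}

theorem eLp_real {X : Type*} [MeasurableSpace X] (μ : Measure X) {N : X → ℝ} (hN0 : ∀ x, 0 ≤ N x)
    {p : ℝ} (hp : 0 < p) :
    eLpNorm N (ENNReal.ofReal p) μ = (∫⁻ x, ENNReal.ofReal (N x ^ p) ∂μ) ^ (1 / p) := by
  rw [eLpNorm_eq_lintegral_rpow_enorm_toReal (by simpa using hp) (by simp), ENNReal.toReal_ofReal hp.le]
  congr 1
  refine lintegral_congr fun x => ?_
  rw [Real.enorm_eq_ofReal (hN0 x), ENNReal.ofReal_rpow_of_nonneg (hN0 x) hp.le]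

theorem eLp_le {X : Type*} [MeasurableSpace X] (μ : Measure X) {N : X → ℝ} (hN0 : ∀ x, 0 ≤ N x)
    {p B : ℝ} (hp : 0 < p) {f : X → ℂ}
    (h : ∫⁻ x, ENNReal.ofReal (N x ^ p) ∂μ ≤ ENNReal.ofReal B * ∫⁻ x, ‖f x‖ₑ ^ p ∂μ) :
    eLpNorm N (ENNReal.ofReal p) μ ≤ ENNReal.ofReal B ^ (1 / p) * eLpNorm f (ENNReal.ofReal p) μ := by
  rw [eLp_real μ hN0 hp, eLpNorm_eq_lintegral_rpow_enorm_toReal (by simpa using hp) (by simp), ENNReal.toReal_ofReal hp.le,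
    ← ENNReal.mul_rpow_of_nonneg _ _ (by positivity)]
  exact ENNReal.rpow_le_rpow h (by positivity)

theorem lp_nice (hd : 0 < d) (hn : 0 < n) (hC : 0 < C) (hα : 0 < α)
    (hα1 : α ≤ 1) {a b c A θ cc p : ℝ} (ha : 40 ≤ a) (hb : 2 * a ^ n ≤ b) (hbd : b = 2 * a ^ d)
    (hc : 0 < c) (hA : 0 < A) (hθ : 0 < θ) (hθ1 : θ ≤ 1)
    (hcc : 1 ≤ cc) (hcca : 20 * cc ≤ a) (hp : 1 < p) :
    ∃ Cb : ℝ≥0∞, Cb ≠ 0 ∧ Cb < ∞ ∧ ∀ μ : Measure (Pt d),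
      (∀ x r, 0 < r → μ (closedBall x r) ≤ ENNReal.ofReal (c * r ^ n)) →
      ∀ K : Pt d → Pt d → ℂ, IsCZKernel K n C α → BigPiece μ K a b cc θ A →
      ∀ ε : ℝ, 0 < ε → ∀ f : Pt d → ℂ, Measurable f → ∀ M R : ℝ, 0 < R → (∀ x, ‖f x‖ ≤ M) →
        (∀ x ∉ closedBall (0 : Pt d) R, f x = 0) →
        eLpNorm (truncT μ K ε f) (ENNReal.ofReal p) μ ≤ Cb * eLpNorm f (ENNReal.ofReal p) μ := by
  have hp0 : 0 < p := by linarith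
  have hp1 : 0 < p - 1 := by linarith
  have ha0 : 0 < a := by linarith
  have hb2 : 2 ≤ b := by
    rw [hbd]
    have : 1 ≤ a ^ d := one_le_pow₀ (by linarith)
    linarith
  have hb0 : 0 < b := by linarith
  set γ := θ / (2 * b) with hγd
  have hγ : 0 < γ := by positivity
  have hγ1 : γ < 1 := by
    rw [hγd, div_lt_one (by positivity)]; linarith
  have hq : 1 < (1 - γ / 2) / (1 - γ) := by
    rw [lt_div_iff₀ (by linarith)]; linarith
  obtain ⟨η, hη, hηe⟩ : ∃ η : ℝ, 0 < η ∧ (1 + η) ^ p * (1 - γ) = 1 - γ / 2 := by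
    refine ⟨((1 - γ / 2) / (1 - γ)) ^ (1 / p) - 1, ?_, ?_⟩
    · have := Real.one_lt_rpow hq (z := 1 / p) (by positivity)
      linarith
    · rw [add_sub_cancel, ← Real.rpow_mul (by linarith), one_div_mul_cancel hp0.ne', Real.rpow_one,
        div_mul_cancel₀ _ (by linarith)]
  have hcl := cloc_pos (n := n) hC hα ha0 hc
  have hAc := Acot_pos (n := n) hC hα ha0 hc hb0 hA
  obtain ⟨δ, hδ, hδ1, hδ2⟩ : ∃ δ : ℝ, 0 < δ ∧ cloc n C α a c * δ ≤ η / 2 ∧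
      2 * Acot n C α a b c A * δ * b / η ≤ θ / (2 * b) := by
    refine ⟨min (η / 2 / cloc n C α a c) (γ * η / (2 * Acot n C α a b c A * b)), by positivity, ?_, ?_⟩
    · have := min_le_left (η / 2 / cloc n C α a c) (γ * η / (2 * Acot n C α a b c A * b))
      rw [le_div_iff₀ hcl] at this
      linarith
    · have := min_le_right (η / 2 / cloc n C α a c) (γ * η / (2 * Acot n C α a b c A * b))
      rw [le_div_iff₀ (by positivity)] at this
      rw [div_le_iff₀ hη]
      linarith
  set B1 := 2 / γ * ((1 + η) ^ p * p) * ((2 / δ) ^ p / (p - 1)) with hB1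
  set B2 := p * ((2 * (C * c * 10 ^ n)) ^ p / (p - 1)) with hB2
  have hB1p : 0 < B1 := by positivity
  refine ⟨ENNReal.ofReal B1 ^ (1 / p) + ENNReal.ofReal B2 ^ (1 / p), ?_, ?_, ?_⟩
  · intro h
    have := (add_eq_zero.1 h).1
    rw [ENNReal.rpow_eq_zero_iff] at this
    rcases this with h | h
    · simp at h; linarith
    · exact absurd h.1 ENNReal.ofReal_ne_top
  · exact ENNReal.add_lt_top.2 ⟨ENNReal.rpow_lt_top_of_nonneg (by positivity) ENNReal.ofReal_ne_top,
      ENNReal.rpow_lt_top_of_nonneg (by positivity) ENNReal.ofReal_ne_top⟩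
  intro μ hμ K hK hBP ε hε f hf M R hR hM hfR
  have hfin : ∀ x r, μ (closedBall x r) ≠ ∞ := by
    intro x r
    refine ne_top_of_le_ne_top ENNReal.ofReal_ne_top
      ((measure_mono (closedBall_subset_closedBall (le_max_left r 1))).trans (hμ x (max r 1) (by positivity)))
  have hρ : dn μ f (closedBall 0 R)ᶜ = 0 := by
    unfold dn
    rw [withDensity_apply _ isClosed_closedBall.measurableSet.compl, setLIntegral_eq_zero_iff isClosed_closedBall.measurableSet.compl (by fun_prop)]
    refine Filter.Eventually.of_forall fun x hx => ?_
    rw [hfR x hx]; simp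
  have : IsFiniteMeasure (dn μ f) := by
    refine ⟨?_⟩
    rw [← measure_add_measure_compl (s := closedBall (0 : Pt d) R) isClosed_closedBall.measurableSet, hρ, add_zero]
    unfold dn
    rw [withDensity_apply _ isClosed_closedBall.measurableSet]
    refine lt_of_le_of_lt (b := ∫⁻ x in closedBall (0 : Pt d) R, ENNReal.ofReal M ∂μ) (lintegral_mono fun x => ?_) ?_
    · rw [← ofReal_norm]; exact ENNReal.ofReal_le_ofReal (hM x)
    · rw [setLIntegral_const]
      exact ENNReal.mul_lt_top ENNReal.ofReal_lt_top (hfin _ _).lt_top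
  have hNm : Measurable fun x => (Ns K ε (dn μ f) (sg f) x).toReal :=
    (Ns_lsc hK hn hC hα hε (dn μ f) (sg_meas hf) (sg_le f)).measurable.ennreal_toReal
  have hNfin : ∀ x, Ns K ε (dn μ f) (sg f) x ≠ ∞ := fun x =>
    ne_top_of_le_ne_top (ENNReal.mul_ne_top ENNReal.ofReal_ne_top (measure_ne_top _ _))
      (Ns_bdd hK hn hC (dn μ f) hε (sg_le f) x)
  have hiff : ∀ t, 0 < t → {x | ENNReal.ofReal t < Ns K ε (dn μ f) (sg f) x} = {x | t < (Ns K ε (dn μ f) (sg f) x).toReal} := by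
    intro t ht
    ext x
    exact ENNReal.ofReal_lt_iff_lt_toReal ht.le (hNfin x)
  have hI := absorb μ hNm (fun x => ENNReal.toReal_nonneg) hp hη hγ hγ1 hηe
    (Nr_fin hK hn hC hc hp μ hμ hε (sg_le f) (dn μ f) hR hρ)
    (fun t => {z | ¬ PP μ (dn μ f) (δ * t) z}) (fun t ht => by
      have := good_lambda hd hK hn hC hα hα1 ha hb hbd hc hA hθ μ hμ hcc hcca hBP hε (sg_meas hf) (sg_le f)
        (dn μ f) hR hρ ht hη hδ hδ1 hδ2
      rw [← hiff t ht, ← hiff _ (by positivity)]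
      refine (measure_mono (t := {z | ENNReal.ofReal ((1 + η) * t) < Ns K ε (dn μ f) (sg f) z ∧ PP μ (dn μ f) (δ * t) z} ∪ {z | ¬ PP μ (dn μ f) (δ * t) z}) ?_).trans
        ((measure_union_le _ _).trans (add_le_add this le_rfl))
      intro z hz
      by_cases hPP : PP μ (dn μ f) (δ * t) z
      · exact Or.inl ⟨hz, hPP⟩
      · exact Or.inr hPP)
  have hI2 : ∫⁻ x, ENNReal.ofReal ((Ns K ε (dn μ f) (sg f) x).toReal ^ p) ∂μ ≤ ENNReal.ofReal B1 * ∫⁻ x, ‖f x‖ₑ ^ p ∂μ := by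
    refine hI.trans ?_
    rw [hB1, ENNReal.ofReal_mul (p := 2 / γ * ((1 + η) ^ p * p)) (by positivity), mul_assoc]
    exact mul_le_mul_right (pp_int μ hf hfin hδ hp) _
  obtain ⟨hmm, hm2⟩ := mass_int hn hC hc μ hf hμ hfin hp hε
  have hm0 : ∀ x, 0 ≤ C / ε ^ n * (dn μ f (closedBall x (2 * ε))).toReal := fun x => by positivity
  rw [add_mul]
  refine le_trans ?_ (add_le_add (eLp_le μ (fun x => ENNReal.toReal_nonneg) hp0 hI2) (eLp_le μ hm0 hp0 hm2))
  refine le_trans ?_ (eLpNorm_add_le hNm.aestronglyMeasurable hmm.aestronglyMeasurable (by simpa using hp.le))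
  refine eLpNorm_mono_real fun x => ?_
  rw [truncT_dn μ hf]
  have := hard_soft hK hn hC hα hε (dn μ f) (sg_meas hf) (sg_le f) x
  rw [← ENNReal.ofReal_toReal (hNfin x), ← ENNReal.ofReal_add ENNReal.toReal_nonneg (hm0 x), ← ofReal_norm] at this
  exact (ENNReal.ofReal_le_ofReal_iff (add_nonneg ENNReal.toReal_nonneg (hm0 x))).1 this

end GLam

namespace GLam

variable {d : ℕ} {n C α : ℝ} {K : Pt d → Pt d → ℂ}

theorem truncT_meas (hK : IsCZKernel K n C α) (hα : 0 < α) {ε : ℝ} (hε : 0 < ε) (μ : Measure (Pt d))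
    [SFinite μ] {f : Pt d → ℂ} (hf : Measurable f) : Measurable (truncT μ K ε f) := by
  have hk : Measurable (Function.uncurry (fun x y => kr K (ε / 2) x y)) :=
    measurable_uncurry_of_continuous_of_measurable (fun y => kr_cont_fst hK hα (by positivity) y)
      (fun x => (kr_cont_snd hK hα (by positivity) x).measurable)
  have hs : MeasurableSet {q : Pt d × Pt d | ε < dist q.1 q.2} :=
    measurableSet_lt measurable_const (by fun_prop)
  have hF : StronglyMeasurable ({q : Pt d × Pt d | ε < dist q.1 q.2}.indicator
      (fun q => Function.uncurry (fun x y => kr K (ε / 2) x y) q * f q.2)) :=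
    ((hk.mul (hf.comp measurable_snd)).indicator hs).stronglyMeasurable
  have := (hF.integral_prod_right' (ν := μ)).measurable
  convert this using 1
  ext x
  unfold truncT
  have hm : MeasurableSet {y : Pt d | ε < dist x y} := measurableSet_lt measurable_const (by fun_prop)
  rw [← integral_indicator hm]
  congr 1
  ext y
  by_cases h : ε < dist x y
  · rw [indicator_of_mem (by exact h), indicator_of_mem (by exact h)]
    simp only [Function.uncurry]
    rw [kr_eq K (by positivity) (by linarith)]
  · rw [indicator_of_notMem (by exact h), indicator_of_notMem (by exact h)]

theorem lp_meas (hK : IsCZKernel K n C α) (hα : 0 < α) {ε p : ℝ} (hε : 0 < ε) (hp : 1 < p) (μ : Measure (Pt d))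
    [SFinite μ] {Cb : ℝ≥0∞}
    (H : ∀ f : Pt d → ℂ, Measurable f → ∀ M R : ℝ, 0 < R → (∀ x, ‖f x‖ ≤ M) →
        (∀ x ∉ closedBall (0 : Pt d) R, f x = 0) →
        eLpNorm (truncT μ K ε f) (ENNReal.ofReal p) μ ≤ Cb * eLpNorm f (ENNReal.ofReal p) μ)
    {f : Pt d → ℂ} (hf : Measurable f) :
    eLpNorm (truncT μ K ε f) (ENNReal.ofReal p) μ ≤ Cb * eLpNorm f (ENNReal.ofReal p) μ := by
  have hp0 : 0 < p := by linarith
  set S : ℕ → Set (Pt d) := fun k => {x | ‖x‖ ≤ (k:ℝ) + 1 ∧ ‖f x‖ ≤ (k:ℝ) + 1} with hS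
  have hSm : ∀ k, MeasurableSet (S k) := fun k => by
    have h1 : MeasurableSet {x : Pt d | ‖x‖ ≤ (k:ℝ) + 1} := measurableSet_le (by fun_prop) measurable_const
    have h2 : MeasurableSet {x : Pt d | ‖f x‖ ≤ (k:ℝ) + 1} := measurableSet_le (by fun_prop) measurable_const
    exact h1.inter h2
  set F : ℕ → Pt d → ℂ := fun k => (S k).indicator f with hF
  have hFm : ∀ k, Measurable (F k) := fun k => hf.indicator (hSm k)
  have hFle : ∀ k x, ‖F k x‖ ≤ ‖f x‖ := fun k x => norm_indicator_le_norm_self _ _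
  have hb : ∀ k, eLpNorm (truncT μ K ε (F k)) (ENNReal.ofReal p) μ ≤ Cb * eLpNorm f (ENNReal.ofReal p) μ := by
    intro k
    refine (H (F k) (hFm k) ((k:ℝ) + 1) ((k:ℝ) + 1) (by positivity) ?_ ?_).trans ?_
    · intro x
      by_cases hx : x ∈ S k
      · rw [hF]; simp only; rw [indicator_of_mem hx]; exact hx.2
      · rw [hF]; simp only; rw [indicator_of_notMem hx]; simp; positivity
    · intro x hx
      refine indicator_of_notMem (fun h => hx ?_) _
      rw [mem_closedBall, dist_zero_right]; exact h.1
    · exact mul_le_mul_right (eLpNorm_mono (hFle k)) _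
  have hpt : ∀ x, ‖truncT μ K ε f x‖ₑ ^ p ≤ Filter.liminf (fun k => ‖truncT μ K ε (F k) x‖ₑ ^ p) Filter.atTop := by
    intro x
    by_cases hi : IntegrableOn (fun y => K x y * f y) {y | ε < dist x y} μ
    · have ht : Filter.Tendsto (fun k => truncT μ K ε (F k) x) Filter.atTop (nhds (truncT μ K ε f x)) := by
        unfold truncT
        refine tendsto_integral_of_dominated_convergence (fun y => ‖K x y * f y‖) ?_ hi.norm ?_ ?_
        · exact fun k => ((K_meas hK hα x).mul (hFm k)).aestronglyMeasurable
        · refine fun k => Filter.Eventually.of_forall fun y => ?_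
          rw [norm_mul, norm_mul]
          exact mul_le_mul_of_nonneg_left (hFle k y) (norm_nonneg _)
        · refine Filter.Eventually.of_forall fun y => ?_
          refine tendsto_const_nhds.congr' ?_
          obtain ⟨k, hk⟩ := exists_nat_ge (max ‖y‖ ‖f y‖)
          filter_upwards [Filter.eventually_ge_atTop k] with j hj
          have hj' : (k:ℝ) ≤ j := by exact_mod_cast hj
          have hy : y ∈ S j := ⟨by linarith [le_max_left ‖y‖ ‖f y‖], by linarith [le_max_right ‖y‖ ‖f y‖]⟩
          rw [hF]; simp only; rw [indicator_of_mem hy]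
      have ht2 : Filter.Tendsto (fun k => ‖truncT μ K ε (F k) x‖ₑ ^ p) Filter.atTop (nhds (‖truncT μ K ε f x‖ₑ ^ p)) :=
        (ENNReal.continuous_rpow_const.tendsto _).comp ht.enorm
      rw [ht2.liminf_eq]
    · have : truncT μ K ε f x = 0 := integral_undef hi
      rw [this]; simp [hp0]
  have hpe : ENNReal.ofReal p ≠ 0 := by simpa using hp0
  rw [eLpNorm_eq_lintegral_rpow_enorm_toReal hpe (by simp), ENNReal.toReal_ofReal hp0.le, one_div,
    ENNReal.rpow_inv_le_iff hp0]
  calc _ ≤ ∫⁻ x, Filter.liminf (fun k => ‖truncT μ K ε (F k) x‖ₑ ^ p) Filter.atTop ∂μ := lintegral_mono hpt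
    _ ≤ Filter.liminf (fun k => ∫⁻ x, ‖truncT μ K ε (F k) x‖ₑ ^ p ∂μ) Filter.atTop := by
        refine lintegral_liminf_le fun k => ?_
        exact (truncT_meas hK hα hε μ (hFm k)).enorm.pow_const _
    _ ≤ Filter.liminf (fun k : ℕ => (Cb * eLpNorm f (ENNReal.ofReal p) μ) ^ p) Filter.atTop := by
        refine Filter.liminf_le_liminf (Filter.Eventually.of_forall fun k => ?_)
        have := hb k
        rwa [eLpNorm_eq_lintegral_rpow_enorm_toReal hpe (by simp), ENNReal.toReal_ofReal hp0.le, one_div,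
          ENNReal.rpow_inv_le_iff hp0] at this
    _ = _ := Filter.liminf_const _

theorem lp_all (hK : IsCZKernel K n C α) (hα : 0 < α) {ε p : ℝ} (hε : 0 < ε) (μ : Measure (Pt d))
    {Cb : ℝ≥0∞}
    (H : ∀ f : Pt d → ℂ, Measurable f →
        eLpNorm (truncT μ K ε f) (ENNReal.ofReal p) μ ≤ Cb * eLpNorm f (ENNReal.ofReal p) μ)
    (f : Pt d → ℂ) :
    eLpNorm (truncT μ K ε f) (ENNReal.ofReal p) μ ≤ Cb * eLpNorm f (ENNReal.ofReal p) μ := by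
  set X : Set (Pt d) := {x | IntegrableOn (fun y => K x y * f y) {y | ε < dist x y} μ} with hX
  set U : Pt d → Set (Pt d) := fun x => {y | ε < dist x y ∧ kr K (ε / 2) x y ≠ 0} with hU
  have hUo : ∀ x, IsOpen (U x) := fun x => by
    have h1 : IsOpen {y : Pt d | ε < dist x y} := isOpen_lt continuous_const (by fun_prop)
    exact h1.inter
      ((kr_cont_snd hK hα (by positivity) x).isOpen_preimage _ isOpen_compl_singleton)
  have hUK : ∀ x y, y ∈ U x ↔ ε < dist x y ∧ K x y ≠ 0 := by
    intro x y
    show (ε < dist x y ∧ kr K (ε / 2) x y ≠ 0) ↔ _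
    refine and_congr_right fun h => ?_
    rw [kr_eq K (by positivity) (by linarith)]
  obtain ⟨T, hTX, hTc, hTU⟩ := TopologicalSpace.isOpen_biUnion_countable X U (fun x _ => hUo x)
  set V := ⋃ x ∈ X, U x with hV
  have hVm : MeasurableSet V := (isOpen_biUnion fun x _ => hUo x).measurableSet
  have hfV : AEMeasurable f (μ.restrict V) := by
    rw [← hTU, biUnion_eq_iUnion]
    have := hTc.to_subtype
    rw [aemeasurable_iUnion_iff]
    rintro ⟨x, hx⟩
    show AEMeasurable f (μ.restrict (U x))
    have hi : IntegrableOn (fun y => K x y * f y) {y | ε < dist x y} μ := hTX hx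
    have h1 : AEMeasurable (fun y => K x y * f y) (μ.restrict (U x)) :=
      (hi.mono_set fun y hy => hy.1).aestronglyMeasurable.aemeasurable
    have h2 : AEMeasurable (fun y => (K x y)⁻¹ * (K x y * f y)) (μ.restrict (U x)) :=
      (K_meas hK hα x).inv.aemeasurable.mul h1
    refine h2.congr ?_
    filter_upwards [ae_restrict_mem (hUo x).measurableSet] with y hy
    rw [inv_mul_cancel_left₀ ((hUK x y).1 hy).2]
  have hf' : AEMeasurable (V.indicator f) μ := (aemeasurable_indicator_iff hVm).2 hfV
  have hcmp : ∀ x, ‖truncT μ K ε f x‖ ≤ ‖truncT μ K ε (hf'.mk _) x‖ := by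
    intro x
    by_cases hx : x ∈ X
    · refine le_of_eq (congrArg _ ?_)
      unfold truncT
      have hm : MeasurableSet {y : Pt d | ε < dist x y} := measurableSet_lt measurable_const (by fun_prop)
      refine integral_congr_ae ?_
      filter_upwards [ae_restrict_mem hm, ae_restrict_of_ae hf'.ae_eq_mk] with y hy he
      rw [← he]
      by_cases hyV : y ∈ V
      · rw [indicator_of_mem hyV]
      · have : K x y = 0 := by
          by_contra h0
          exact hyV (mem_biUnion hx ((hUK x y).2 ⟨hy, h0⟩))
        simp [this]
    · have : truncT μ K ε f x = 0 := integral_undef hx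
      rw [this]; simp
  refine (eLpNorm_mono hcmp).trans ((H _ hf'.measurable_mk).trans (mul_le_mul_right ?_ _))
  rw [eLpNorm_congr_ae hf'.ae_eq_mk.symm]
  exact eLpNorm_mono fun x => norm_indicator_le_norm_self _ _

theorem cube_closed (Q : Cube d) : IsClosed Q.toSet := by
  unfold Cube.toSet
  simp only [ofPred_forall]
  exact isClosed_iInter fun i => isClosed_le (by fun_prop) continuous_const

theorem bigPiece_of (hd : 0 < d) {a b₀ b C₁ θ A : ℝ} (hda : 10 * d ≤ a) (hb0 : 0 < b₀) (hbb : b₀ ≤ b)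
    (hC1 : 40 * b₀ < C₁) (μ : Measure (Pt d)) (hfin : ∀ x r, μ (closedBall x r) ≠ ∞)
    (h : ∀ Q : Cube d, 0 < Q.side → IsDoubling μ 5 b Q → SmallBoundary μ C₁ Q →
          ∃ G : Set (Pt d), G ⊆ Q.toSet ∧ ENNReal.ofReal θ * μ Q.toSet ≤ μ G ∧
            ∀ ρ : Measure (Pt d), IsFiniteMeasure ρ →
              ∀ g : Pt d → ℂ, (∀ x, ‖g x‖ ≤ 1) →
                ∀ ε : ℝ, 0 < ε → ∀ lam : ℝ, 0 < lam →
                  ENNReal.ofReal lam *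
                      (μ.restrict G) {x | ENNReal.ofReal lam < (‖truncT ρ K ε g x‖₊ : ℝ≥0∞)}
                    ≤ ENNReal.ofReal A * ρ Set.univ) :
    BigPiece μ K a b₀ (2 * (d + 1)) (min θ 1) A := by
  intro x s hs hdb
  obtain ⟨Q, hQ, hBQ, hQB, hQ5, hSB⟩ := small_bdry hd μ x hs hda hb0 hC1 (hfin _ _) hdb
  have hD : IsDoubling μ 5 b Q := by
    refine (measure_mono hQ5).trans (hdb.trans ?_)
    gcongr
  obtain ⟨G, hGQ, hGm, hG⟩ := h Q hQ hD hSB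
  have hGfin : μ G ≠ ∞ := ne_top_of_le_ne_top (hfin _ _) (measure_mono (hGQ.trans hQB))
  refine ⟨toMeasurable μ G ∩ Q.toSet, (measurableSet_toMeasurable _ _).inter (cube_closed Q).measurableSet, ?_, ?_, ?_⟩
  · refine inter_subset_right.trans (hQB.trans (closedBall_subset_closedBall ?_))
    nlinarith
  · calc _ ≤ ENNReal.ofReal θ * μ Q.toSet := by
          gcongr; exact min_le_left _ _
      _ ≤ μ G := hGm
      _ ≤ _ := measure_mono (subset_inter (subset_toMeasurable _ _) hGQ)
  · intro ρ hρ g hg ε hε lam hlam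
    refine le_trans (mul_le_mul_right ?_ _) (hG ρ hρ g hg ε hε lam hlam)
    rw [← Measure.restrict_toMeasurable hGfin]
    exact Measure.restrict_mono inter_subset_left le_rfl _

end GLam
/-- **Good lambda method with small-boundary cubes.**
Suppose that every `(5,b)`-doubling cube `Q` with `C₁`-small boundary contains a big piece
`G ⊆ Q`, `μ(G) ≥ θ μ(Q)`, on which the maximal truncations are bounded from `M(ℝ^d)` into
`L^{1,∞}(μ⌊G)` with a uniform norm `A`.  (A finite complex measure `ν` is encoded by its polar
decomposition `ν = g·ρ` with `ρ` a finite positive measure and `‖g‖ ≤ 1`, so that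
`‖ν‖ ≤ ρ(ℝ^d)`.)  Then `T_μ` is bounded on `L^p(μ)` for every `1 < p < ∞`, uniformly in the
truncation parameter. -/
theorem good_lambda_small_boundaries (d : ℕ) :
    ∃ b₀ C₁₀ : ℝ, 0 < b₀ ∧ 0 < C₁₀ ∧
      ∀ b C₁ : ℝ, b₀ ≤ b → C₁₀ ≤ C₁ →
      ∀ n C₀ C α θ A : ℝ, 0 < n → n ≤ d → 0 < C₀ → 0 < C → 0 < α → α ≤ 1 →
        0 < θ → 0 < A →
      ∀ p : ℝ, 1 < p →
      ∃ Cb : ℝ≥0∞, Cb < ∞ ∧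
        ∀ μ : Measure (Pt d), HasDegree μ n C₀ →
        ∀ K : Pt d → Pt d → ℂ, IsCZKernel K n C α →
        (∀ Q : Cube d, 0 < Q.side → IsDoubling μ 5 b Q → SmallBoundary μ C₁ Q →
          ∃ G : Set (Pt d), G ⊆ Q.toSet ∧ ENNReal.ofReal θ * μ Q.toSet ≤ μ G ∧
            ∀ ρ : Measure (Pt d), IsFiniteMeasure ρ →
              ∀ g : Pt d → ℂ, (∀ x, ‖g x‖ ≤ 1) →
                ∀ ε : ℝ, 0 < ε → ∀ lam : ℝ, 0 < lam →
                  ENNReal.ofReal lam *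
                      (μ.restrict G) {x | ENNReal.ofReal lam < (‖truncT ρ K ε g x‖₊ : ℝ≥0∞)}
                    ≤ ENNReal.ofReal A * ρ Set.univ) →
        ∀ ε : ℝ, 0 < ε → ∀ f : Pt d → ℂ,
          eLpNorm (truncT μ K ε f) (ENNReal.ofReal p) μ
            ≤ Cb * eLpNorm f (ENNReal.ofReal p) μ := by
  refine ⟨2 * (100 * ((d : ℝ) + 1)) ^ d, 41 * (2 * (100 * ((d : ℝ) + 1)) ^ d), by positivity, by positivity, ?_⟩
  intro b C₁ hb hC₁ n C₀ C α θ A hn hnd hC₀ hC hα hα1 hθ hA p hp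
  have hdR : (0:ℝ) < d := by linarith
  have hd : 0 < d := by exact_mod_cast hdR
  set a : ℝ := 100 * ((d : ℝ) + 1) with ha
  have ha1 : 1 ≤ a := by rw [ha]; linarith
  have hbn : 2 * a ^ n ≤ 2 * a ^ d := by
    rw [← Real.rpow_natCast]
    have := Real.rpow_le_rpow_of_exponent_le ha1 hnd
    linarith
  have hb0 : 0 < 2 * a ^ d := by positivity
  obtain ⟨Cb, hCb0, hCb, H⟩ := GLam.lp_nice (d := d) (a := a) (b := 2 * a ^ d) (c := C₀ * 2 ^ n)
    (θ := min θ 1) (cc := 2 * ((d : ℝ) + 1)) hd hn hC hα hα1 (by rw [ha]; linarith) hbn rfl (by positivity) hA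
    (by positivity) (min_le_right _ _) (by linarith) (by rw [ha]; linarith) hp
  refine ⟨Cb, hCb, ?_⟩
  intro μ hμ K hK hG ε hε f
  have hμ' : ∀ x r, 0 < r → μ (closedBall x r) ≤ ENNReal.ofReal (C₀ * 2 ^ n * r ^ n) := by
    intro x r hr
    refine (measure_mono (closedBall_subset_ball (by linarith : r < 2 * r))).trans ((hμ x (2 * r) (by positivity)).trans (le_of_eq ?_))
    rw [Real.mul_rpow (by norm_num) hr.le, mul_assoc]
  have hfin : ∀ x r, μ (closedBall x r) ≠ ∞ := by
    intro x r
    refine ne_top_of_le_ne_top ENNReal.ofReal_ne_top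
      ((measure_mono (closedBall_subset_closedBall (le_max_left r 1))).trans (hμ' x (max r 1) (by positivity)))
  have : IsLocallyFiniteMeasure μ :=
    ⟨fun x => ⟨closedBall x 1, closedBall_mem_nhds x one_pos, (hfin x 1).lt_top⟩⟩
  have hBP := GLam.bigPiece_of hd (a := a) (by rw [ha]; linarith) hb0 hb (by linarith) μ hfin hG
  exact GLam.lp_all hK hα hε μ (fun f hf => GLam.lp_meas hK hα hε hp μ (H μ hμ' K hK hBP ε hε) hf) f
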